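/- Deletion-restriction for multiplicity: With the notation of deletion-restriction (A arrangement defined by f, A' = A \ {H_0} defined by f', restriction A'' to H_0 defined by f'' in R'' = R/(h_0)), one has mult H^1_{(f)}(R) = mult H^1_{(f')}(R) + mult H^1_{(f'')}(R'') + 1. -/

import Mathlib

open Polynomial MvPolynomial

/-- Defining relations of the `n`-th Weyl algebra over `K`:
generators `Sum.inl i` are the multiplication operators `x_i`, generators
`Sum.inr i` are the partial derivations `∂_i`. -/
inductive WeylRel (K : Type) [Field K] (n : ℕ) :
    FreeAlgebra K (Fin n ⊕ Fin n) → FreeAlgebra K (Fin n ⊕ Fin n) → Prop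
  | xx (i j : Fin n) : WeylRel K n
      (FreeAlgebra.ι K (Sum.inl i) * FreeAlgebra.ι K (Sum.inl j))
      (FreeAlgebra.ι K (Sum.inl j) * FreeAlgebra.ι K (Sum.inl i))
  | dd (i j : Fin n) : WeylRel K n
      (FreeAlgebra.ι K (Sum.inr i) * FreeAlgebra.ι K (Sum.inr j))
      (FreeAlgebra.ι K (Sum.inr j) * FreeAlgebra.ι K (Sum.inr i))
  | dx (i j : Fin n) : WeylRel K n
      (FreeAlgebra.ι K (Sum.inr i) * FreeAlgebra.ι K (Sum.inl j))
      (FreeAlgebra.ι K (Sum.inl j) * FreeAlgebra.ι K (Sum.inr i)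
        + if i = j then 1 else 0)

/-- The `n`-th Weyl algebra `D_n` over `K`. -/
abbrev Weyl (K : Type) [Field K] (n : ℕ) : Type := RingQuot (WeylRel K n)

/-- The operator `x_i ∈ D_n`. -/
noncomputable def wX (K : Type) [Field K] (n : ℕ) (i : Fin n) : Weyl K n :=
  RingQuot.mkAlgHom K (WeylRel K n) (FreeAlgebra.ι K (Sum.inl i))

/-- The operator `∂_i ∈ D_n`. -/
noncomputable def wD (K : Type) [Field K] (n : ℕ) (i : Fin n) : Weyl K n :=
  RingQuot.mkAlgHom K (WeylRel K n) (FreeAlgebra.ι K (Sum.inr i))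

/-- The Bernstein filtration on the Weyl algebra: `F_k(D_n)` is spanned by the
monomials `x^α ∂^β` with `|α| + |β| ≤ k`. -/
noncomputable def bernsteinF (K : Type) [Field K] (n : ℕ) (k : ℤ) :
    Submodule K (Weyl K n) :=
  Submodule.span K {w | ∃ α β : Fin n → ℕ,
    ((∑ i, α i : ℕ) + (∑ i, β i : ℕ) : ℤ) ≤ k ∧
    w = ((List.finRange n).map fun i => wX K n i ^ α i).prod *
        ((List.finRange n).map fun i => wD K n i ^ β i).prod}

/-- A good Bernstein filtration on a left `D_n`-module `M`. -/
structure GoodFiltration (K : Type) [Field K] (n : ℕ) (M : Type)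
    [AddCommGroup M] [Module K M] [Module (Weyl K n) M]
    [IsScalarTower K (Weyl K n) M] (F : ℤ → Submodule K M) : Prop where
  mono : ∀ k, F k ≤ F (k + 1)
  exhaustive : ∀ m : M, ∃ k, m ∈ F k
  compat : ∀ j k : ℤ, ∀ w ∈ bernsteinF K n j, ∀ m ∈ F k, w • m ∈ F (j + k)
  bddBelow : ∃ k₀ : ℤ, ∀ k < k₀, F k = ⊥
  finiteDim : ∀ k, FiniteDimensional K (F k)
  good : ∃ k₁ : ℤ, ∀ k ≥ k₁, ∀ j ≥ (0 : ℤ),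
    F (j + k) ≤ Submodule.span K
      {m | ∃ w ∈ bernsteinF K n j, ∃ v ∈ F k, m = w • v}

/-- `HasMult K n M m` : the holonomic module `M` admits a good Bernstein filtration
whose Hilbert polynomial `h` satisfies `(deg h)! · (leading coeff of h) = m`; i.e.
the multiplicity of `M` is `m`. -/
def HasMult (K : Type) [Field K] (n : ℕ) (M : Type)
    [AddCommGroup M] [Module K M] [Module (Weyl K n) M]
    [IsScalarTower K (Weyl K n) M] (m : ℚ) : Prop :=
  ∃ F : ℤ → Submodule K M, GoodFiltration K n M F ∧
    ∃ h : Polynomial ℚ,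
      (∃ N : ℤ, ∀ k ≥ N, (Module.finrank K (F k) : ℚ) = h.eval (k : ℚ)) ∧
      m = (Nat.factorial h.natDegree : ℚ) * h.leadingCoeff

/-- `M` is a holonomic left `D_n`-module. -/
def IsHolonomic (K : Type) [Field K] (n : ℕ) (M : Type)
    [AddCommGroup M] [Module K M] [Module (Weyl K n) M]
    [IsScalarTower K (Weyl K n) M] : Prop :=
  Subsingleton M ∨
  ∃ F : ℤ → Submodule K M, GoodFiltration K n M F ∧
    ∃ h : Polynomial ℚ,
      (∃ N : ℤ, ∀ k ≥ N, (Module.finrank K (F k) : ℚ) = h.eval (k : ℚ)) ∧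
      h.natDegree = n

/-- The length of a module: the Krull dimension of its lattice of submodules. -/
noncomputable def mlength (A : Type) [Ring A] (M : Type) [AddCommGroup M]
    [Module A M] : WithBot ℕ∞ :=
  Order.krullDim (Submodule A M)

section LocalCoh
variable (K : Type) [Field K] (n : ℕ)

/-- The zero set in `K^n` of a polynomial. -/
def zeroSet (p : MvPolynomial (Fin n) K) : Set (Fin n → K) :=
  {x | MvPolynomial.eval x p = 0}

/-- The property that a given `D_n`-module structure on the localization
`R[f⁻¹]` is the natural one: `x_i` acts by multiplication and `∂_i` acts as the
(unique) derivation of `R[f⁻¹]` extending `∂/∂x_i` on `R`. -/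
def NatActs (f : MvPolynomial (Fin n) K)
    [Module (Weyl K n) (Localization.Away f)] : Prop :=
  (∀ (i : Fin n) (m : Localization.Away f),
      wX K n i • m =
        algebraMap (MvPolynomial (Fin n) K) (Localization.Away f)
          (MvPolynomial.X i) * m) ∧
  (∀ i : Fin n, ∃ δ : Derivation K (Localization.Away f) (Localization.Away f),
      (∀ m, wD K n i • m = δ m) ∧
      ∀ r : MvPolynomial (Fin n) K,
        δ (algebraMap (MvPolynomial (Fin n) K) (Localization.Away f) r) =
          algebraMap (MvPolynomial (Fin n) K) (Localization.Away f)
            (MvPolynomial.pderiv i r))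

/-- The first local cohomology module `H¹_{(f)}(R) = R[f⁻¹]/R` as a left
`D_n`-module. -/
noncomputable abbrev H1 (f : MvPolynomial (Fin n) K)
    [Module (Weyl K n) (Localization.Away f)] : Type :=
  (Localization.Away f) ⧸ Submodule.span (Weyl K n)
    (Set.range (algebraMap (MvPolynomial (Fin n) K) (Localization.Away f)))

end LocalCoh

section Arrangement
open scoped Classical
variable (K : Type) [Field K] (n : ℕ)

/-- The intersection poset of an arrangement `𝒜` of hyperplanes inside the
ambient affine subspace `V0`: all nonempty intersections of subfamilies
(including the ambient space `V0` itself, as the empty intersection). -/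
noncomputable def interPoset (V0 : Set (Fin n → K))
    (𝒜 : Finset (Set (Fin n → K))) : Finset (Set (Fin n → K)) :=
  (𝒜.powerset.image fun S => V0 ∩ ⋂ H ∈ S, H).filter fun X => X ≠ ∅

/-- Codimension of `X` inside the ambient affine subspace `V0`. -/
noncomputable def codim (V0 X : Set (Fin n → K)) : ℕ :=
  Module.finrank K (vectorSpan K V0) - Module.finrank K (vectorSpan K X)

/-- `μ` is the Möbius function of the intersection poset of `𝒜` (with ambient
space `V0`), for the order `X ≤ Y ↔ X ⊇ Y`. -/
def IsMobius (V0 : Set (Fin n → K)) (𝒜 : Finset (Set (Fin n → K)))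
    (μ : Set (Fin n → K) → ℤ) : Prop :=
  μ V0 = 1 ∧
  ∀ Y ∈ interPoset K n V0 𝒜, Y ≠ V0 →
    ∑ Z ∈ (interPoset K n V0 𝒜).filter fun Z => Y ⊆ Z, μ Z = 0

/-- The Poincaré polynomial `π(𝒜,t) = ∑_{X ∈ L(𝒜)} μ(X)(−t)^{codim X}`. -/
noncomputable def poin (V0 : Set (Fin n → K)) (𝒜 : Finset (Set (Fin n → K)))
    (μ : Set (Fin n → K) → ℤ) : Polynomial ℤ :=
  ∑ X ∈ interPoset K n V0 𝒜, Polynomial.C (μ X) * (- Polynomial.X) ^ codim K n V0 X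

end Arrangement

section HilbertPolynomials

open Filter

theorem leadingCoeff_nonneg_of_eventually_nonneg {P : Polynomial ℚ}
    (hP : ∀ᶠ k : ℕ in atTop, 0 ≤ P.eval (k : ℚ)) : 0 ≤ P.leadingCoeff := by
  by_contra! hneg
  rcases Nat.eq_zero_or_pos P.natDegree with hdeg | hdeg
  · rw [Polynomial.eq_C_of_natDegree_eq_zero hdeg] at hP hneg
    obtain ⟨k, hk⟩ := hP.exists
    simp only [Polynomial.eval_C, Polynomial.leadingCoeff_C] at hk hneg
    linarith
  · have := (P.tendsto_atBot_of_leadingCoeff_nonpos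
      (Polynomial.natDegree_pos_iff_degree_pos.mp hdeg) hneg.le).comp
      (tendsto_natCast_atTop_atTop (R := ℚ))
    obtain ⟨k, hk, hk'⟩ := (hP.and (this.eventually_lt_atBot 0)).exists
    exact absurd hk (not_le.mpr hk')

theorem lead_le_of_eventually_le {P Q : Polynomial ℚ} (hlc : 0 < P.leadingCoeff)
    (hPQ : ∀ᶠ k : ℕ in atTop, P.eval (k : ℚ) ≤ Q.eval (k : ℚ)) :
    P.natDegree ≤ Q.natDegree ∧
      (P.natDegree = Q.natDegree → P.leadingCoeff ≤ Q.leadingCoeff) := by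
  have hsub : 0 ≤ (Q - P).leadingCoeff := by
    apply leadingCoeff_nonneg_of_eventually_nonneg
    filter_upwards [hPQ] with k hk
    simpa using hk
  constructor
  · by_contra! hlt
    rw [Polynomial.leadingCoeff_sub_of_degree_lt' (Polynomial.degree_lt_degree hlt)] at hsub
    linarith
  · intro hdeg
    by_contra! hlt
    have hcoeff : (Q - P).coeff P.natDegree = Q.leadingCoeff - P.leadingCoeff := by
      rw [Polynomial.coeff_sub, Polynomial.leadingCoeff, Polynomial.leadingCoeff, hdeg]
    have hnat : (Q - P).natDegree = P.natDegree := by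
      apply le_antisymm
      · exact (Polynomial.natDegree_sub_le _ _).trans (by simp [hdeg])
      · exact Polynomial.le_natDegree_of_ne_zero (by rw [hcoeff]; linarith)
    rw [Polynomial.leadingCoeff, hnat, hcoeff] at hsub
    linarith

/-- The Hilbert polynomial `k ↦ ℓ * (k + n).choose n`. -/
noncomputable def standardHilbertPolynomial (n ℓ : ℕ) : Polynomial ℚ :=
  Polynomial.C ((ℓ : ℚ) / n.factorial) * (ascPochhammer ℚ n).comp (Polynomial.X + Polynomial.C 1)

theorem standardHilbertPolynomial_eval (n ℓ k : ℕ) :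
    (standardHilbertPolynomial n ℓ).eval (k : ℚ) = ((ℓ * (k + n).choose n : ℕ) : ℚ) := by
  have h : ((k + 1).ascFactorial n : ℚ) = n.factorial * (k + n).choose n := by
    exact_mod_cast Nat.ascFactorial_eq_factorial_mul_choose k n
  have h' : (ascPochhammer ℚ n).eval ((k : ℚ) + 1) = n.factorial * (k + n).choose n := by
    rw [← h, ← ascPochhammer_nat_eq_ascFactorial, ascPochhammer_eval_cast]
    push_cast
    rfl
  have hn : (n.factorial : ℚ) ≠ 0 := by positivity
  rw [standardHilbertPolynomial, Polynomial.eval_mul, Polynomial.eval_C, Polynomial.eval_comp]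
  simp only [Polynomial.eval_add, Polynomial.eval_X, Polynomial.eval_C, h']
  push_cast
  field_simp

theorem standardHilbertPolynomial_natDegree {n ℓ : ℕ} (hℓ : 0 < ℓ) :
    (standardHilbertPolynomial n ℓ).natDegree = n := by
  have : ((ℓ : ℚ) / n.factorial) ≠ 0 := by positivity
  rw [standardHilbertPolynomial, Polynomial.natDegree_C_mul this, Polynomial.natDegree_comp,
    ascPochhammer_natDegree, Polynomial.natDegree_X_add_C, mul_one]

theorem standardHilbertPolynomial_leadingCoeff (n ℓ : ℕ) :
    (standardHilbertPolynomial n ℓ).leadingCoeff = (ℓ : ℚ) / n.factorial := by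
  rw [standardHilbertPolynomial, Polynomial.leadingCoeff_mul, Polynomial.leadingCoeff_C,
    Polynomial.leadingCoeff_comp (by rw [Polynomial.natDegree_X_add_C]; exact one_ne_zero),
    (monic_ascPochhammer ℚ n).leadingCoeff, (Polynomial.monic_X_add_C 1).leadingCoeff]
  simp

theorem leadingCoeff_comp_X_add_C (P : Polynomial ℚ) (a : ℚ) :
    (P.comp (Polynomial.X + Polynomial.C a)).leadingCoeff = P.leadingCoeff := by
  rw [Polynomial.leadingCoeff_comp (by rw [Polynomial.natDegree_X_add_C]; exact one_ne_zero),
    (Polynomial.monic_X_add_C a).leadingCoeff]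
  simp

theorem natDegree_comp_X_add_C (P : Polynomial ℚ) (a : ℚ) :
    (P.comp (Polynomial.X + Polynomial.C a)).natDegree = P.natDegree := by
  rw [Polynomial.natDegree_comp, Polynomial.natDegree_X_add_C, mul_one]

/-- A polynomial squeezed between shifts of `k ↦ ℓ * (k + n).choose n` has normalized leading
coefficient `ℓ`. -/
theorem factorial_mul_leadingCoeff_eq {n ℓ a b : ℕ} {h : Polynomial ℚ}
    (hlow : ∀ᶠ k : ℕ in atTop, ((ℓ * (k + n).choose n : ℕ) : ℚ) ≤ h.eval ((k + a : ℕ) : ℚ))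
    (hupp : ∀ᶠ k : ℕ in atTop, h.eval (k : ℚ) ≤ ((ℓ * (k + b + n).choose n : ℕ) : ℚ)) :
    (h.natDegree.factorial : ℚ) * h.leadingCoeff = ℓ := by
  set q := standardHilbertPolynomial n ℓ with hq
  have hlow' : ∀ᶠ k : ℕ in atTop,
      q.eval (k : ℚ) ≤ (h.comp (Polynomial.X + Polynomial.C (a : ℚ))).eval (k : ℚ) := by
    filter_upwards [hlow] with k hk
    rw [hq, standardHilbertPolynomial_eval]
    simpa using hk
  have hupp' : ∀ᶠ k : ℕ in atTop,
      h.eval (k : ℚ) ≤ (q.comp (Polynomial.X + Polynomial.C (b : ℚ))).eval (k : ℚ) := by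
    filter_upwards [hupp] with k hk
    rw [Polynomial.eval_comp]
    simp only [Polynomial.eval_add, Polynomial.eval_X, Polynomial.eval_C]
    rw [← Nat.cast_add, hq, standardHilbertPolynomial_eval]
    exact hk
  rcases Nat.eq_zero_or_pos ℓ with rfl | hℓ
  · have h0 : q = 0 := by simp [hq, standardHilbertPolynomial]
    have hnn : 0 ≤ (h.comp (Polynomial.X + Polynomial.C (a : ℚ))).leadingCoeff := by
      apply leadingCoeff_nonneg_of_eventually_nonneg
      filter_upwards [hlow'] with k hk
      simpa [h0] using hk
    have hnp : 0 ≤ (-h).leadingCoeff := by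
      apply leadingCoeff_nonneg_of_eventually_nonneg
      filter_upwards [hupp'] with k hk
      simpa [h0] using hk
    rw [leadingCoeff_comp_X_add_C] at hnn
    rw [Polynomial.leadingCoeff_neg] at hnp
    have : h.leadingCoeff = 0 := by linarith
    simp [this]
  · have hqlc : 0 < q.leadingCoeff := by
      rw [hq, standardHilbertPolynomial_leadingCoeff]
      positivity
    obtain ⟨hd1, hl1⟩ := lead_le_of_eventually_le hqlc hlow'
    rw [natDegree_comp_X_add_C] at hd1 hl1
    rw [leadingCoeff_comp_X_add_C] at hl1
    have hhlc : 0 < h.leadingCoeff := by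
      rcases hd1.eq_or_lt with heq | hlt
      · exact hqlc.trans_le (hl1 heq)
      · refine lt_of_le_of_ne ?_ ?_
        · rw [← leadingCoeff_comp_X_add_C h a]
          apply leadingCoeff_nonneg_of_eventually_nonneg
          filter_upwards [hlow'] with k hk
          refine le_trans ?_ hk
          rw [hq, standardHilbertPolynomial_eval]
          positivity
        · intro h0
          rw [eq_comm, Polynomial.leadingCoeff_eq_zero] at h0
          simp [h0] at hlt
    obtain ⟨hd2, hl2⟩ := lead_le_of_eventually_le hhlc hupp'
    rw [natDegree_comp_X_add_C] at hd2 hl2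
    rw [leadingCoeff_comp_X_add_C] at hl2
    have hd : h.natDegree = q.natDegree := le_antisymm hd2 hd1
    have hl : h.leadingCoeff = q.leadingCoeff := le_antisymm (hl2 hd) (hl1 hd.symm)
    rw [hd, hl, hq, standardHilbertPolynomial_leadingCoeff, standardHilbertPolynomial_natDegree hℓ]
    field_simp

theorem sum_range_multichoose (n k : ℕ) :
    ∑ j ∈ Finset.range (k + 1), n.multichoose j = (n + 1).multichoose k := by
  induction k with
  | zero => simp
  | succ k ih => rw [Finset.sum_range_succ, ih, Nat.multichoose_succ_succ, add_comm]

theorem finrank_restrictTotalDegree (K : Type*) [Field K] (n k : ℕ) :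
    Module.finrank K (MvPolynomial.restrictTotalDegree (Fin n) K k) = (k + n).choose n := by
  have hset : {s : Fin n →₀ ℕ | (s.sum fun _ e => e) ≤ k} =
      ((Finset.range (k + 1)).biUnion fun j => (Finset.univ : Finset (Fin n)).finsuppAntidiag j) := by
    ext s
    simp [Finset.mem_finsuppAntidiag, Finsupp.sum_fintype]
  have hcard : Nat.card {s : Fin n →₀ ℕ | (s.sum fun _ e => e) ≤ k} = (k + n).choose n := by
    rw [hset, Nat.card_coe_set_eq, Set.ncard_coe_finset, Finset.card_biUnion]
    · simp_rw [Finset.card_finsuppAntidiag_nat_eq_multichoose]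
      rw [Finset.card_univ, Fintype.card_fin, sum_range_multichoose, Nat.multichoose_eq]
      rw [show n + 1 + k - 1 = k + n by omega, Nat.choose_symm_add]
    · intro i _ j _ hij
      rw [Function.onFun, Finset.disjoint_left]
      intro s hs hs'
      rw [Finset.mem_finsuppAntidiag] at hs hs'
      exact hij (hs.1.symm.trans hs'.1)
  rw [← hcard]
  exact Module.finrank_eq_nat_card_basis (MvPolynomial.basisRestrictSupport K _)

end HilbertPolynomials

section PartialDerivatives

variable {K σ : Type*} [Field K]

theorem totalDegree_pderiv_lt {p : MvPolynomial σ K} {i : σ} (h : MvPolynomial.pderiv i p ≠ 0) :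
    (MvPolynomial.pderiv i p).totalDegree < p.totalDegree := by
  have key : ∀ m ∈ (MvPolynomial.pderiv i p).support,
      (m.sum fun _ e => e) < p.totalDegree := by
    intro m hm
    rw [MvPolynomial.mem_support_iff, MvPolynomial.coeff_pderiv] at hm
    have := MvPolynomial.le_totalDegree (MvPolynomial.mem_support_iff.mpr (left_ne_zero_of_mul hm))
    rw [Finsupp.sum_add_index' (fun _ => rfl) (fun _ _ _ => rfl),
      Finsupp.sum_single_index rfl] at this
    exact this
  obtain ⟨m, hm⟩ := MvPolynomial.support_nonempty.mpr h
  exact (Finset.sup_lt_iff (Nat.zero_le _ |>.trans_lt (key m hm))).mpr key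

theorem eq_C_of_pderiv_eq_zero [CharZero K] {p : MvPolynomial σ K}
    (h : ∀ i, MvPolynomial.pderiv i p = 0) : p = MvPolynomial.C (MvPolynomial.coeff 0 p) := by
  classical
  ext m
  rw [MvPolynomial.coeff_C]
  split_ifs with hm
  · rw [hm]
  · obtain ⟨i, hi⟩ : ∃ i, m i ≠ 0 := by
      by_contra! hall
      exact hm (Finsupp.ext fun i => (hall i).symm)
    have hc := MvPolynomial.coeff_pderiv (i := i) p (m - Finsupp.single i 1)
    rw [h i, MvPolynomial.coeff_zero,
      tsub_add_cancel_of_le (Finsupp.single_le_iff.mpr (Nat.one_le_iff_ne_zero.mpr hi))] at hc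
    exact (mul_eq_zero.mp hc.symm).resolve_right (Nat.cast_add_one_ne_zero _)

end PartialDerivatives

section CanonicalChains

variable {K D : Type*} [Field K] [Ring D] [Algebra K D]

/-- A canonical frame of a space `W` of operators: coordinates `Θ X_i` and conjugate momenta `y_i`
which, together with `1`, span `W`. -/
structure IsCanonicalFrame (W : Submodule K D) {n : ℕ} (y : Fin n → D)
    (Θ : MvPolynomial (Fin n) K →ₐ[K] D) : Prop where
  momentum_mem : ∀ i, y i ∈ W
  coord_mem : ∀ i, Θ (MvPolynomial.X i) ∈ W
  le_span : W ≤ Submodule.span K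
    ({1} ∪ Set.range y ∪ Set.range fun i => Θ (MvPolynomial.X i))
  momentum_mul : ∀ i p, y i * Θ p = Θ p * y i + Θ (MvPolynomial.pderiv i p)

theorem momentum_mul_of_coords {n : ℕ} {y : Fin n → D} {Θ : MvPolynomial (Fin n) K →ₐ[K] D}
    (h : ∀ i j, y i * Θ (MvPolynomial.X j) = Θ (MvPolynomial.X j) * y i + if i = j then 1 else 0)
    (i : Fin n) (p : MvPolynomial (Fin n) K) :
    y i * Θ p = Θ p * y i + Θ (MvPolynomial.pderiv i p) := by
  induction p using MvPolynomial.induction_on with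
  | C a =>
    rw [← MvPolynomial.algebraMap_eq, AlgHom.commutes, Derivation.map_algebraMap, map_zero,
      add_zero, Algebra.commutes]
  | add p q hp hq =>
    rw [map_add, map_add, map_add, mul_add, add_mul, hp, hq]
    abel
  | mul_X p j hp =>
    have hX : Θ (MvPolynomial.pderiv i (MvPolynomial.X j)) = if i = j then 1 else 0 := by
      rw [MvPolynomial.pderiv_X]
      by_cases hij : i = j
      · subst hij; simp
      · simp [hij, Ne.symm hij]
    rw [Derivation.leibniz, smul_eq_mul, smul_eq_mul, map_add, map_mul, map_mul, map_mul, hX,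
      ← mul_assoc, hp, add_mul, mul_assoc, h, mul_add, ← map_mul Θ _ (MvPolynomial.pderiv i p),
      mul_comm (MvPolynomial.X j), map_mul]
    noncomm_ring

/-- Evaluation of polynomials at a commuting family of operators. -/
theorem exists_algHom_of_commute {σ : Type*} (z : σ → D)
    (hz : ∀ i j, z i * z j = z j * z i) :
    ∃ Θ : MvPolynomial σ K →ₐ[K] D, ∀ i, Θ (MvPolynomial.X i) = z i := by
  have hcomm : ∀ a ∈ Set.range z, ∀ b ∈ Set.range z, a * b = b * a := by
    rintro _ ⟨i, rfl⟩ _ ⟨j, rfl⟩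
    exact hz i j
  let _ : CommRing (Algebra.adjoin K (Set.range z)) :=
    { (inferInstance : Ring (Algebra.adjoin K (Set.range z))) with
      mul_comm := (Algebra.isMulCommutative_adjoin K hcomm).is_comm.comm }
  refine ⟨(Algebra.adjoin K (Set.range z)).val.comp
    (MvPolynomial.aeval (R := K)
      fun i => (⟨z i, Algebra.subset_adjoin ⟨i, rfl⟩⟩ : Algebra.adjoin K (Set.range z))), fun i => ?_⟩
  simp

variable {M M' : Type*} [AddCommGroup M] [Module K M] [Module D M] [IsScalarTower K D M]
  [AddCommGroup M'] [Module K M'] [Module D M'] [IsScalarTower K D M']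

/-- The orbit map `p ↦ Θ p • u`. -/
noncomputable def orbitMap {n : ℕ} (Θ : MvPolynomial (Fin n) K →ₐ[K] D) (u : M) :
    MvPolynomial (Fin n) K →ₗ[K] M :=
  ((LinearMap.toSpanSingleton D M u).restrictScalars K) ∘ₗ Θ.toLinearMap

@[simp]
theorem orbitMap_apply {n : ℕ} (Θ : MvPolynomial (Fin n) K →ₐ[K] D) (u : M)
    (p : MvPolynomial (Fin n) K) : orbitMap Θ u p = Θ p • u := rfl

/-- `CanonicalChain W n N P ℓ`: the subspace `P` is obtained from `N` in `ℓ` steps, each of which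
adjoins an element killed, modulo what precedes, by the momenta of a canonical frame. -/
inductive CanonicalChain (W : Submodule K D) (n : ℕ) :
    Submodule K M → Submodule K M → ℕ → Prop
  | refl (N : Submodule K M) : CanonicalChain W n N N 0
  | step {N P : Submodule K M} {ℓ : ℕ} {y : Fin n → D} {Θ : MvPolynomial (Fin n) K →ₐ[K] D}
      {u : M} (hNP : CanonicalChain W n N P ℓ) (hframe : IsCanonicalFrame W y Θ) (hu : u ∉ P)
      (hy : ∀ i, y i • u ∈ P) : CanonicalChain W n N (P ⊔ LinearMap.range (orbitMap Θ u)) (ℓ + 1)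

namespace CanonicalChain

variable {W : Submodule K D} {n : ℕ}

theorem le {N P : Submodule K M} {ℓ : ℕ} (h : CanonicalChain W n N P ℓ) : N ≤ P := by
  induction h with
  | refl => exact le_rfl
  | step _ _ _ _ ih => exact ih.trans le_sup_left

theorem trans {N P Q : Submodule K M} {ℓ m : ℕ} (h : CanonicalChain W n N P ℓ)
    (h' : CanonicalChain W n P Q m) : CanonicalChain W n N Q (ℓ + m) := by
  induction h' with
  | refl => exact h
  | step _ hframe hu hy ih => exact ih.step hframe hu hy

theorem map_orbit {k : ℕ} (φ : M →ₗ[D] M') (Θ : MvPolynomial (Fin k) K →ₐ[K] D) (u : M) :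
    (LinearMap.range (orbitMap Θ u)).map (φ.restrictScalars K) =
      LinearMap.range (orbitMap Θ (φ u)) := by
  rw [← LinearMap.range_comp]
  congr 1
  ext p
  simp

theorem map {N P : Submodule K M} {ℓ : ℕ} (h : CanonicalChain W n N P ℓ) (φ : M →ₗ[D] M')
    (hφ : ∀ m, φ m = 0 → m ∈ N) :
    CanonicalChain W n (N.map (φ.restrictScalars K)) (P.map (φ.restrictScalars K)) ℓ := by
  induction h with
  | refl => exact refl _
  | @step P ℓ y Θ u hNP hframe hu hy ih =>
    rw [Submodule.map_sup, map_orbit]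
    refine ih.step hframe ?_ fun i => ?_
    · rintro ⟨m, hm, hmu⟩
      have : m - u ∈ P := hNP.le (hφ _ (by rw [map_sub]; exact sub_eq_zero.mpr hmu))
      exact hu (by simpa using P.sub_mem hm this)
    · rw [← map_smul]
      exact Submodule.mem_map_of_mem (f := φ.restrictScalars K) (hy i)

theorem comap {N P : Submodule K M'} {ℓ : ℕ} (h : CanonicalChain W n N P ℓ) (φ : M →ₗ[D] M')
    (hφ : Function.Surjective φ) :
    CanonicalChain W n (N.comap (φ.restrictScalars K)) (P.comap (φ.restrictScalars K)) ℓ := by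
  induction h with
  | refl => exact refl _
  | @step P ℓ y Θ u hNP hframe hu hy ih =>
    obtain ⟨v, rfl⟩ := hφ u
    have hker : LinearMap.ker (φ.restrictScalars K) ≤ P.comap (φ.restrictScalars K) :=
      LinearMap.ker_le_comap _
    have : (P ⊔ LinearMap.range (orbitMap Θ (φ v))).comap (φ.restrictScalars K) =
        P.comap (φ.restrictScalars K) ⊔ LinearMap.range (orbitMap Θ v) := by
      rw [← map_orbit, ← Submodule.map_comap_eq_of_surjective (f := φ.restrictScalars K) hφ P,
        ← Submodule.map_sup, Submodule.comap_map_eq,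
        Submodule.map_comap_eq_of_surjective (f := φ.restrictScalars K) hφ P, sup_assoc,
        sup_comm _ (LinearMap.ker _), ← sup_assoc, sup_eq_left.mpr hker]
    rw [this]
    refine ih.step hframe hu fun i => ?_
    have := hy i
    rw [← map_smul] at this
    exact this

end CanonicalChain

/-- A subspace stable under a space of operators. -/
def IsStableUnder (W : Submodule K D) (P : Submodule K M) : Prop :=
  ∀ w ∈ W, ∀ m ∈ P, w • m ∈ P

theorem IsCanonicalFrame.smul_mem_of_mem {W : Submodule K D} {n : ℕ} {y : Fin n → D}
    {Θ : MvPolynomial (Fin n) K →ₐ[K] D} (hframe : IsCanonicalFrame W y Θ)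
    {P Q : Submodule K M} (hPQ : P ≤ Q) (hy : ∀ i, ∀ m ∈ P, y i • m ∈ Q)
    (hz : ∀ i, ∀ m ∈ P, Θ (MvPolynomial.X i) • m ∈ Q) {w : D} (hw : w ∈ W) {m : M} (hm : m ∈ P) :
    w • m ∈ Q := by
  have hle : W ≤ Q.comap ((LinearMap.toSpanSingleton D M m).restrictScalars K) := by
    refine hframe.le_span.trans (Submodule.span_le.mpr ?_)
    rintro _ ((h | ⟨i, rfl⟩) | ⟨i, rfl⟩)
    · obtain rfl := Set.mem_singleton_iff.mp h
      simpa using hPQ hm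
    · exact hy i m hm
    · exact hz i m hm
  exact hle hw

theorem IsStableUnder.poly_smul_mem {W : Submodule K D} {P : Submodule K M}
    (hP : IsStableUnder W P) {n : ℕ} {Θ : MvPolynomial (Fin n) K →ₐ[K] D}
    (hΘ : ∀ i, Θ (MvPolynomial.X i) ∈ W) (p : MvPolynomial (Fin n) K) {m : M} (hm : m ∈ P) :
    Θ p • m ∈ P := by
  induction p using MvPolynomial.induction_on generalizing m with
  | C a =>
    rw [← MvPolynomial.algebraMap_eq, AlgHom.commutes, algebraMap_smul]
    exact P.smul_mem a hm
  | add p q hp hq =>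
    rw [map_add, add_smul]
    exact P.add_mem (hp hm) (hq hm)
  | mul_X p j hp =>
    rw [map_mul, mul_smul]
    exact hp (hP _ (hΘ j) _ hm)

theorem IsCanonicalFrame.momentum_smul_orbit {V : Type*} [AddCommGroup V] [Module D V] {W : Submodule K D} {n : ℕ} {y : Fin n → D}
    {Θ : MvPolynomial (Fin n) K →ₐ[K] D} (hframe : IsCanonicalFrame W y Θ) (i : Fin n)
    (p : MvPolynomial (Fin n) K) (u : V) :
    y i • Θ p • u = Θ p • y i • u + Θ (MvPolynomial.pderiv i p) • u := by
  rw [smul_smul, hframe.momentum_mul, add_smul, mul_smul]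

theorem CanonicalChain.isStableUnder {W : Submodule K D} {n : ℕ} {N P : Submodule K M} {ℓ : ℕ}
    (h : CanonicalChain W n N P ℓ) (hN : IsStableUnder W N) : IsStableUnder W P := by
  induction h with
  | refl => exact hN
  | @step P ℓ y Θ u hNP hframe hu hy ih =>
    have hP := ih
    intro w hw m hm
    refine hframe.smul_mem_of_mem le_rfl (fun i => ?_) (fun i => ?_) hw hm
    · intro m hm
      obtain ⟨a, ha, _, ⟨p, rfl⟩, rfl⟩ := Submodule.mem_sup.mp hm
      rw [smul_add]
      refine add_mem (Submodule.mem_sup_left (hP _ (hframe.momentum_mem i) _ ha)) ?_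
      rw [orbitMap_apply, hframe.momentum_smul_orbit]
      exact add_mem (Submodule.mem_sup_left (hP.poly_smul_mem hframe.coord_mem p (hy i)))
        (Submodule.mem_sup_right ⟨_, rfl⟩)
    · intro m hm
      obtain ⟨a, ha, _, ⟨p, rfl⟩, rfl⟩ := Submodule.mem_sup.mp hm
      rw [smul_add]
      refine add_mem (Submodule.mem_sup_left (hP _ (hframe.coord_mem i) _ ha))
        (Submodule.mem_sup_right ⟨MvPolynomial.X i * p, ?_⟩)
      rw [orbitMap_apply, map_mul, mul_smul, orbitMap_apply]

/-- The orbit of an element killed by the momenta modulo `P` is free modulo `P`. -/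
theorem IsCanonicalFrame.eq_zero_of_poly_smul_mem [CharZero K] {W : Submodule K D} {n : ℕ}
    {y : Fin n → D} {Θ : MvPolynomial (Fin n) K →ₐ[K] D} (hframe : IsCanonicalFrame W y Θ)
    {P : Submodule K M} (hP : IsStableUnder W P) {u : M} (hu : u ∉ P) (hy : ∀ i, y i • u ∈ P)
    (p : MvPolynomial (Fin n) K) (hp : Θ p • u ∈ P) : p = 0 := by
  induction hd : p.totalDegree using Nat.strong_induction_on generalizing p with
  | _ d ih =>
    have hder : ∀ i, MvPolynomial.pderiv i p = 0 := by
      intro i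
      by_contra hne
      have hmem : Θ (MvPolynomial.pderiv i p) • u ∈ P := by
        have h1 := hP _ (hframe.momentum_mem i) _ hp
        rw [hframe.momentum_smul_orbit] at h1
        exact (P.add_mem_iff_right (hP.poly_smul_mem hframe.coord_mem p (hy i))).mp h1
      have hlt : (MvPolynomial.pderiv i p).totalDegree < d := by
        rw [← hd]
        exact totalDegree_pderiv_lt hne
      exact hne (ih _ hlt _ hmem rfl)
    have hC := eq_C_of_pderiv_eq_zero hder
    rw [hC] at hp ⊢
    by_contra hne
    have ha : MvPolynomial.coeff 0 p ≠ 0 := fun h0 => hne (by rw [h0, map_zero])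
    rw [← MvPolynomial.algebraMap_eq, AlgHom.commutes, algebraMap_smul] at hp
    exact hu ((P.smul_mem_iff ha).mp hp)

end CanonicalChains

section Growth

variable {K D M : Type*} [Field K] [Ring D] [Algebra K D]
  [AddCommGroup M] [Module K M] [Module D M] [IsScalarTower K D M]

/-- An increasing filtration on which the operators in `W` have degree one. -/
structure IsOperatorFiltration (W : Submodule K D) (F : ℕ → Submodule K M) : Prop where
  mono : Monotone F
  smul_mem : ∀ k, ∀ w ∈ W, ∀ m ∈ F k, w • m ∈ F (k + 1)

variable {W : Submodule K D} {F : ℕ → Submodule K M} {n : ℕ}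

theorem IsOperatorFiltration.monomial_smul_mem (hF : IsOperatorFiltration W F)
    {Θ : MvPolynomial (Fin n) K →ₐ[K] D} (hΘ : ∀ i, Θ (MvPolynomial.X i) ∈ W) (a : K) (d : ℕ)
    (s : Fin n →₀ ℕ) (hs : (s.sum fun _ e => e) = d) {j : ℕ} {m : M} (hm : m ∈ F j) :
    Θ (MvPolynomial.monomial s a) • m ∈ F (j + d) := by
  induction d generalizing s j m with
  | zero =>
    obtain rfl : s = 0 := by
      ext i
      rw [Finsupp.sum_fintype _ _ fun _ => rfl] at hs
      exact (Finset.sum_eq_zero_iff.mp hs) i (Finset.mem_univ i)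
    rw [← MvPolynomial.C_apply, ← MvPolynomial.algebraMap_eq, AlgHom.commutes, algebraMap_smul]
    exact (F j).smul_mem a hm
  | succ d ih =>
    obtain ⟨i, hi⟩ : ∃ i, s i ≠ 0 := by
      by_contra! hall
      obtain rfl : s = 0 := Finsupp.ext hall
      simp at hs
    have hdec : s = (s - Finsupp.single i 1) + Finsupp.single i 1 :=
      (tsub_add_cancel_of_le (Finsupp.single_le_iff.mpr (Nat.one_le_iff_ne_zero.mpr hi))).symm
    rw [hdec] at hs ⊢
    rw [Finsupp.sum_add_index' (fun _ => rfl) (fun _ _ _ => rfl),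
      Finsupp.sum_single_index rfl, Nat.add_right_cancel_iff] at hs
    rw [MvPolynomial.monomial_add_single, pow_one, map_mul, mul_smul]
    have := ih _ hs (hF.smul_mem j _ (hΘ i) m hm)
    rwa [show j + (d + 1) = j + 1 + d by ring]

theorem IsOperatorFiltration.poly_smul_mem (hF : IsOperatorFiltration W F)
    {Θ : MvPolynomial (Fin n) K →ₐ[K] D} (hΘ : ∀ i, Θ (MvPolynomial.X i) ∈ W)
    {p : MvPolynomial (Fin n) K} {k : ℕ} (hp : p.totalDegree ≤ k) {j : ℕ} {m : M}
    (hm : m ∈ F j) : Θ p • m ∈ F (j + k) := by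
  rw [p.as_sum, map_sum, Finset.sum_smul]
  refine Submodule.sum_mem _ fun s hs => ?_
  exact hF.mono (Nat.add_le_add_left ((MvPolynomial.le_totalDegree hs).trans hp) j)
    (hF.monomial_smul_mem hΘ _ _ s rfl hm)

theorem CanonicalChain.exists_lower_bound [CharZero K] {P : Submodule K M} {ℓ : ℕ}
    (h : CanonicalChain W n ⊥ P ℓ) (hF : IsOperatorFiltration W F)
    (hfin : ∀ k, FiniteDimensional K (F k)) (hex : ∀ m, ∃ k, m ∈ F k) :
    ∃ c, ∀ k, ℓ * (k + n).choose n ≤ Module.finrank K ↥(F (k + c) ⊓ P) := by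
  induction h with
  | refl => exact ⟨0, fun k => by simp⟩
  | @step P ℓ y Θ u hP hframe hu hy ih =>
    obtain ⟨c, hc⟩ := ih
    obtain ⟨c', hc'⟩ := hex u
    have hstable : IsStableUnder W P := hP.isStableUnder fun w _ m hm => by
      rw [Submodule.mem_bot] at hm ⊢
      rw [hm, smul_zero]
    have hfree := fun p => hframe.eq_zero_of_poly_smul_mem hstable hu hy p
    refine ⟨c + c', fun k => ?_⟩
    have := hfin (k + (c + c'))
    set A : Submodule K M := F (k + (c + c')) ⊓ P with hA
    set B : Submodule K M :=
      (MvPolynomial.restrictTotalDegree (Fin n) K k).map (orbitMap Θ u) with hB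
    have hinj : Function.Injective (orbitMap Θ u) := by
      rw [injective_iff_map_eq_zero]
      intro p hp
      apply hfree
      rw [← orbitMap_apply, hp]
      exact P.zero_mem
    have hBF : B ≤ F (k + (c + c')) := by
      rintro _ ⟨p, hp, rfl⟩
      have := hF.poly_smul_mem hframe.coord_mem
        ((MvPolynomial.mem_restrictTotalDegree _ _ _).mp hp) hc'
      exact hF.mono (by omega) this
    have hAB : A ⊓ B = ⊥ := by
      rw [eq_bot_iff]
      rintro _ ⟨⟨-, hm⟩, ⟨p, -, rfl⟩⟩
      rw [hfree p hm, map_zero]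
      exact Submodule.zero_mem _
    have hle : A ⊔ B ≤ F (k + (c + c')) ⊓ (P ⊔ LinearMap.range (orbitMap Θ u)) :=
      sup_le (inf_le_inf_left _ le_sup_left)
        (le_inf hBF ((LinearMap.map_le_range).trans le_sup_right))
    have hsum := Submodule.finrank_sup_add_finrank_inf_eq A B
    have hfinB : Module.finrank K B = (k + n).choose n := by
      rw [← finrank_restrictTotalDegree K n k]
      exact ((Submodule.equivMapOfInjective (orbitMap Θ u) hinj _).finrank_eq).symm
    have : FiniteDimensional K B := Submodule.finiteDimensional_of_le hBF
    rw [hAB, finrank_bot, add_zero, hfinB] at hsum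
    have hmono : Module.finrank K ↥(F (k + c) ⊓ P) ≤ Module.finrank K A :=
      Submodule.finrank_mono (inf_le_inf_right _ (hF.mono (by omega)))
    have := Submodule.finrank_mono hle
    have := hc k
    rw [add_mul, one_mul]
    omega

theorem CanonicalChain.exists_filtration {P : Submodule K M} {ℓ : ℕ}
    (h : CanonicalChain W n ⊥ P ℓ) :
    ∃ (G : ℕ → Submodule K M) (c : ℕ), IsOperatorFiltration W G ∧
      (∀ k, FiniteDimensional K (G k)) ∧ (∀ m ∈ P, ∃ k, m ∈ G k) ∧
      ∀ k, Module.finrank K (G k) ≤ ℓ * (k + c + n).choose n := by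
  induction h with
  | refl =>
    refine ⟨fun _ => ⊥, 0, ⟨fun _ _ _ => le_rfl, fun k w _ m hm => ?_⟩, fun k => ?_,
      fun m hm => ⟨0, hm⟩, fun k => by simp⟩
    · rw [Submodule.mem_bot] at hm ⊢
      rw [hm, smul_zero]
    · infer_instance
  | @step P ℓ y Θ u hP hframe hu hy ih =>
    obtain ⟨G, c, hG, hfin, hex, hdim⟩ := ih
    choose d hd using fun i => hex _ (hy i)
    set c' := Finset.univ.sup d with hc'
    have hyG : ∀ i, y i • u ∈ G c' := fun i => hG.mono (Finset.le_sup (Finset.mem_univ i)) (hd i)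
    have hmono : Monotone fun k => G (k + c') ⊔
        (MvPolynomial.restrictTotalDegree (Fin n) K k).map (orbitMap Θ u) := by
      intro k k' hk
      refine sup_le_sup (hG.mono (by omega)) (Submodule.map_mono fun p hp => ?_)
      rw [MvPolynomial.mem_restrictTotalDegree] at hp ⊢
      exact hp.trans hk
    refine ⟨fun k => G (k + c') ⊔
      (MvPolynomial.restrictTotalDegree (Fin n) K k).map (orbitMap Θ u), c' + c,
      ⟨hmono, fun k w hw m hm => ?_⟩, fun k => ?_, fun m hm => ?_, fun k => ?_⟩
    · refine hframe.smul_mem_of_mem (hmono (Nat.le_succ k)) (fun i => ?_) (fun i => ?_) hw hm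
      · intro m hm
        obtain ⟨a, ha, _, ⟨p, hp, rfl⟩, rfl⟩ := Submodule.mem_sup.mp hm
        have hp' := (MvPolynomial.mem_restrictTotalDegree _ _ _).mp hp
        rw [smul_add, orbitMap_apply, hframe.momentum_smul_orbit]
        refine add_mem (Submodule.mem_sup_left ?_) (add_mem (Submodule.mem_sup_left ?_)
          (Submodule.mem_sup_right ⟨_, ?_, rfl⟩))
        · exact hG.mono (by omega) (hG.smul_mem _ _ (hframe.momentum_mem i) _ ha)
        · exact hG.mono (by omega) (hG.poly_smul_mem hframe.coord_mem hp' (hyG i))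
        · rw [SetLike.mem_coe, MvPolynomial.mem_restrictTotalDegree]
          by_cases h0 : MvPolynomial.pderiv i p = 0
          · rw [h0, MvPolynomial.totalDegree_zero]
            exact Nat.zero_le _
          · have := totalDegree_pderiv_lt h0
            omega
      · intro m hm
        obtain ⟨a, ha, _, ⟨p, hp, rfl⟩, rfl⟩ := Submodule.mem_sup.mp hm
        have hp' := (MvPolynomial.mem_restrictTotalDegree _ _ _).mp hp
        rw [smul_add, orbitMap_apply, smul_smul, ← map_mul]
        refine add_mem (Submodule.mem_sup_left ?_) (Submodule.mem_sup_right ⟨_, ?_, rfl⟩)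
        · exact hG.mono (by omega) (hG.smul_mem _ _ (hframe.coord_mem i) _ ha)
        · rw [SetLike.mem_coe, MvPolynomial.mem_restrictTotalDegree]
          refine (MvPolynomial.totalDegree_mul _ _).trans ?_
          rw [MvPolynomial.totalDegree_X]
          omega
    · have := hfin (k + c')
      infer_instance
    · obtain ⟨a, ha, _, ⟨p, rfl⟩, rfl⟩ := Submodule.mem_sup.mp hm
      obtain ⟨k, hk⟩ := hex a ha
      refine ⟨k + p.totalDegree, add_mem (Submodule.mem_sup_left (hG.mono (by omega) hk))
        (Submodule.mem_sup_right ⟨p, ?_, rfl⟩)⟩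
      rw [SetLike.mem_coe, MvPolynomial.mem_restrictTotalDegree]
      omega
    · have := hfin (k + c')
      have h1 := Submodule.finrank_add_le_finrank_add_finrank (G (k + c'))
        ((MvPolynomial.restrictTotalDegree (Fin n) K k).map (orbitMap Θ u))
      have h2 := Submodule.finrank_map_le (orbitMap Θ u)
        (MvPolynomial.restrictTotalDegree (Fin n) K k)
      rw [finrank_restrictTotalDegree] at h2
      have h3 := hdim (k + c')
      have h4 : (k + n).choose n ≤ (k + (c' + c) + n).choose n := Nat.choose_le_choose n (by omega)
      rw [show k + c' + c = k + (c' + c) by ring] at h3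
      refine h1.trans ?_
      rw [add_mul, one_mul]
      omega

end Growth

section OperatorLists

variable {K D M : Type*} [Field K] [Ring D] [Algebra K D]
  [AddCommGroup M] [Module K M] [Module D M]

theorem IsOperatorFiltration.pow_smul_mem {W : Submodule K D} {F : ℕ → Submodule K M}
    (hF : IsOperatorFiltration W F) {w : D} (hw : w ∈ W) (d : ℕ) {k : ℕ} {m : M} (hm : m ∈ F k) :
    w ^ d • m ∈ F (k + d) := by
  induction d with
  | zero => simpa using hm
  | succ d ih =>
    rw [pow_succ', mul_smul]
    exact hF.smul_mem _ _ hw _ ih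

theorem IsOperatorFiltration.list_prod_smul_mem {W : Submodule K D} {F : ℕ → Submodule K M}
    (hF : IsOperatorFiltration W F) {ι : Type*} {g : ι → D} (hg : ∀ i, g i ∈ W) (α : ι → ℕ)
    (l : List ι) {k : ℕ} {m : M} (hm : m ∈ F k) :
    (l.map fun i => g i ^ α i).prod • m ∈ F (k + (l.map α).sum) := by
  induction l with
  | nil => simpa using hm
  | cons i l ih =>
    simp only [List.map_cons, List.prod_cons, mul_smul, List.sum_cons]
    rw [add_comm (α i), ← add_assoc]
    exact hF.pow_smul_mem (hg i) _ ih

theorem CanonicalChain.quotient [IsScalarTower K D M] {W : Submodule K D} {n : ℕ} {N : Submodule D M} {ℓ : ℕ}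
    (h : CanonicalChain W n (N.restrictScalars K) ⊤ ℓ) :
    CanonicalChain W n (⊥ : Submodule K (M ⧸ N)) ⊤ ℓ := by
  have h' := h.map N.mkQ fun m hm => (Submodule.Quotient.mk_eq_zero N).mp hm
  convert h' using 1
  · symm
    rw [Submodule.eq_bot_iff]
    rintro _ ⟨m, hm, rfl⟩
    exact (Submodule.Quotient.mk_eq_zero N).mpr hm
  · rw [eq_comm, Submodule.map_top, LinearMap.range_eq_top]
    exact N.mkQ_surjective

theorem exists_le_of_monotone_of_exhaustive {F : ℕ → Submodule K M} (hmono : Monotone F)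
    (hex : ∀ m, ∃ k, m ∈ F k) (P : Submodule K M) [FiniteDimensional K P] : ∃ k, P ≤ F k := by
  obtain ⟨s, hs⟩ := (Submodule.fg_iff_finiteDimensional P).mpr inferInstance
  choose d hd using hex
  refine ⟨s.sup d, ?_⟩
  rw [← hs, Submodule.span_le]
  intro m hm
  exact hmono (Finset.le_sup hm) (hd m)

end OperatorLists

section Multiplicity

variable (K : Type) [Field K] (n : ℕ)

/-- The span of `1`, the `x_i` and the `∂_i` in the Weyl algebra. -/
noncomputable def weylLinear : Submodule K (Weyl K n) :=
  Submodule.span K ({1} ∪ Set.range (wX K n) ∪ Set.range (wD K n))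

variable {K n}

theorem wX_mem_weylLinear (i : Fin n) : wX K n i ∈ weylLinear K n :=
  Submodule.subset_span (Or.inl (Or.inr ⟨i, rfl⟩))

theorem wD_mem_weylLinear (i : Fin n) : wD K n i ∈ weylLinear K n :=
  Submodule.subset_span (Or.inr ⟨i, rfl⟩)

theorem one_mem_weylLinear : (1 : Weyl K n) ∈ weylLinear K n :=
  Submodule.subset_span (Or.inl (Or.inl rfl))

theorem list_prod_pow_single {D : Type*} [Monoid D] (g : Fin n → D) (i : Fin n) :
    ((List.finRange n).map fun j => g j ^ (Pi.single i 1 : Fin n → ℕ) j).prod = g i := by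
  rw [List.prod_map_eq_pow_single i, List.count_eq_one_of_mem (List.nodup_finRange n)
    (List.mem_finRange i)]
  · simp
  · intro j hj _
    simp [hj]

theorem weylLinear_le_bernsteinF : weylLinear K n ≤ bernsteinF K n 1 := by
  refine Submodule.span_le.mpr ?_
  rintro _ ((h | ⟨i, rfl⟩) | ⟨i, rfl⟩)
  · obtain rfl := Set.mem_singleton_iff.mp h
    exact Submodule.subset_span ⟨0, 0, by simp, by simp⟩
  · refine Submodule.subset_span ⟨Pi.single i 1, 0, by simp, ?_⟩
    rw [list_prod_pow_single]
    simp
  · refine Submodule.subset_span ⟨0, Pi.single i 1, by simp, ?_⟩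
    rw [list_prod_pow_single]
    simp

variable {M : Type} [AddCommGroup M] [Module K M] [Module (Weyl K n) M]
  [IsScalarTower K (Weyl K n) M]

theorem IsOperatorFiltration.bernstein_smul_mem {G : ℕ → Submodule K M}
    (hG : IsOperatorFiltration (weylLinear K n) G) {j : ℕ} {w : Weyl K n}
    (hw : w ∈ bernsteinF K n j) {k : ℕ} {m : M} (hm : m ∈ G k) : w • m ∈ G (k + j) := by
  have hle : bernsteinF K n j ≤
      (G (k + j)).comap ((LinearMap.toSpanSingleton (Weyl K n) M m).restrictScalars K) := by
    refine Submodule.span_le.mpr ?_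
    rintro _ ⟨α, β, hαβ, rfl⟩
    have h1 := hG.list_prod_smul_mem wD_mem_weylLinear β (List.finRange n) hm
    have h2 := hG.list_prod_smul_mem wX_mem_weylLinear α (List.finRange n) h1
    rw [smul_smul] at h2
    refine hG.mono ?_ h2
    rw [← Fin.sum_univ_def, ← Fin.sum_univ_def]
    have hαβ' : ((∑ i, α i + ∑ i, β i : ℕ) : ℤ) ≤ j := by exact_mod_cast hαβ
    omega
  exact hle hw

theorem GoodFiltration.monotone {F : ℤ → Submodule K M} (hF : GoodFiltration K n M F) :
    Monotone F :=
  monotone_int_of_le_succ hF.mono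

theorem GoodFiltration.isOperatorFiltration {F : ℤ → Submodule K M}
    (hF : GoodFiltration K n M F) :
    IsOperatorFiltration (weylLinear K n) fun k : ℕ => F k where
  mono _ _ hk := hF.monotone (by exact_mod_cast hk)
  smul_mem k w hw m hm := by
    have := hF.compat 1 k w (weylLinear_le_bernsteinF hw) m hm
    rwa [add_comm] at this

theorem GoodFiltration.exhaustive_nat {F : ℤ → Submodule K M}
    (hF : GoodFiltration K n M F) (m : M) : ∃ k : ℕ, m ∈ F k := by
  obtain ⟨k, hk⟩ := hF.exhaustive m
  exact ⟨k.toNat, hF.monotone (Int.self_le_toNat k) hk⟩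

theorem HasMult.eq_of_chain [CharZero K] {m : ℚ} (hm : HasMult K n M m) {ℓ : ℕ}
    (hchain : CanonicalChain (weylLinear K n) n (⊥ : Submodule K M) ⊤ ℓ) : m = ℓ := by
  obtain ⟨F, hF, h, ⟨N, hN⟩, rfl⟩ := hm
  obtain ⟨a, ha⟩ := hchain.exists_lower_bound hF.isOperatorFiltration
    (fun k => hF.finiteDim k) hF.exhaustive_nat
  obtain ⟨G, c, hG, hGfin, hGex, hGdim⟩ := hchain.exists_filtration
  obtain ⟨k₁, hk₁⟩ := hF.good
  have := hF.finiteDim k₁.toNat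
  obtain ⟨d, hd⟩ := exists_le_of_monotone_of_exhaustive hG.mono
    (fun m => hGex m Submodule.mem_top) (F k₁.toNat)
  refine factorial_mul_leadingCoeff_eq (n := n) (a := a) (b := d + c) ?_ ?_
  · filter_upwards [Filter.eventually_ge_atTop N.toNat] with k hk
    have := hN ((k + a : ℕ) : ℤ) (by omega)
    rw [Int.cast_natCast] at this
    rw [← this, Nat.cast_le]
    have := ha k
    rwa [inf_top_eq] at this
  · filter_upwards [Filter.eventually_ge_atTop N.toNat,
      Filter.eventually_ge_atTop k₁.toNat] with k hk hk'
    have := hN (k : ℤ) (by omega)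
    rw [Int.cast_natCast] at this
    rw [← this, Nat.cast_le]
    have hle : F k ≤ G (k + d) := by
      have h1 := hk₁ k₁.toNat (Int.self_le_toNat k₁) ((k - k₁.toNat : ℕ) : ℤ) (by omega)
      rw [show ((k - k₁.toNat : ℕ) : ℤ) + (k₁.toNat : ℤ) = k by omega] at h1
      refine h1.trans (Submodule.span_le.mpr ?_)
      rintro _ ⟨w, hw, v, hv, rfl⟩
      exact hG.mono (by omega) (hG.bernstein_smul_mem hw (hd hv))
    have := hGfin (k + d)
    refine (Submodule.finrank_mono hle).trans ((hGdim (k + d)).trans_eq ?_)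
    rw [add_assoc k d c]

/-- The subspace `R` of a localization `R[f⁻¹]`. -/
noncomputable abbrev polyRange (f : MvPolynomial (Fin n) K) : Submodule K (Localization.Away f) :=
  LinearMap.range (IsScalarTower.toAlgHom K (MvPolynomial (Fin n) K)
    (Localization.Away f)).toLinearMap

theorem weyl_induction {C : Weyl K n → Prop} (algebraMap : ∀ a : K, C (algebraMap K _ a))
    (wX : ∀ i, C (wX K n i)) (wD : ∀ i, C (wD K n i)) (add : ∀ v w, C v → C w → C (v + w))
    (mul : ∀ v w, C v → C w → C (v * w)) (w : Weyl K n) : C w := by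
  obtain ⟨a, rfl⟩ := RingQuot.mkAlgHom_surjective K (WeylRel K n) w
  induction a using FreeAlgebra.induction with
  | grade0 a => rw [AlgHom.commutes]; exact algebraMap a
  | grade1 i => exact i.casesOn wX wD
  | mul a b ha hb => rw [map_mul]; exact mul _ _ ha hb
  | add a b ha hb => rw [map_add]; exact add _ _ ha hb

theorem weyl_smul_mem {P : Submodule K M} (hX : ∀ i, ∀ m ∈ P, wX K n i • m ∈ P)
    (hD : ∀ i, ∀ m ∈ P, wD K n i • m ∈ P) (w : Weyl K n) {m : M} (hm : m ∈ P) : w • m ∈ P := by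
  induction w using weyl_induction generalizing m with
  | algebraMap a => rw [algebraMap_smul]; exact P.smul_mem a hm
  | wX i => exact hX i m hm
  | wD i => exact hD i m hm
  | add v w hv hw => rw [add_smul]; exact P.add_mem (hv hm) (hw hm)
  | mul v w hv hw => rw [mul_smul]; exact hv (hw hm)

theorem NatActs.smul_mem_polyRange {f : MvPolynomial (Fin n) K}
    [Module (Weyl K n) (Localization.Away f)] [IsScalarTower K (Weyl K n) (Localization.Away f)]
    (hf : NatActs K n f) (w : Weyl K n) {m : Localization.Away f} (hm : m ∈ polyRange f) :
    w • m ∈ polyRange f := by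
  refine weyl_smul_mem (fun i => ?_) (fun i => ?_) w hm
  · rintro _ ⟨r, rfl⟩
    exact ⟨MvPolynomial.X i * r, by simp [hf.1]⟩
  · rintro _ ⟨r, rfl⟩
    obtain ⟨δ, hδ, hδr⟩ := hf.2 i
    exact ⟨MvPolynomial.pderiv i r, by simp [hδ, hδr]⟩

theorem NatActs.mult_H1_eq [CharZero K] {f : MvPolynomial (Fin n) K}
    [Module (Weyl K n) (Localization.Away f)] [IsScalarTower K (Weyl K n) (Localization.Away f)]
    (hf : NatActs K n f) {ℓ : ℕ} (hchain : CanonicalChain (weylLinear K n) n (polyRange f) ⊤ ℓ)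
    {m : ℚ} (hm : HasMult K n (H1 K n f) m) : m = ℓ := by
  have hspan : (Submodule.span (Weyl K n) (Set.range (algebraMap (MvPolynomial (Fin n) K)
      (Localization.Away f)))).restrictScalars K = polyRange f := by
    refine le_antisymm (fun m hm => ?_) ?_
    · refine Submodule.span_induction ?_ (Submodule.zero_mem _) (fun _ _ _ _ => add_mem)
        (fun w _ _ => hf.smul_mem_polyRange w) hm
      rintro _ ⟨r, rfl⟩
      exact ⟨r, rfl⟩
    · rintro _ ⟨r, rfl⟩
      exact Submodule.subset_span ⟨r, rfl⟩
  exact hm.eq_of_chain (hspan ▸ hchain).quotient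

end Multiplicity

section NormalCrossing

variable {K D D' : Type*} [Field K] [Ring D] [Algebra K D] [Ring D'] [Algebra K D']

/-- The operators `t`, `τ` form a canonical pair commuting with the image of `D'` in `D`, and
together with the image of `W'` they span `W`. -/
structure IsTransversal (W : Submodule K D) (W' : Submodule K D') (φ : D' →ₐ[K] D) (t τ : D) :
    Prop where
  t_mem : t ∈ W
  τ_mem : τ ∈ W
  map_mem : ∀ w ∈ W', φ w ∈ W
  le_span : W ≤ Submodule.span K {1, t, τ} ⊔ W'.map φ.toLinearMap
  τ_mul_t : τ * t = t * τ + 1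
  t_comm : ∀ w, t * φ w = φ w * t
  τ_comm : ∀ w, τ * φ w = φ w * τ

variable {W : Submodule K D} {W' : Submodule K D'} {φ : D' →ₐ[K] D} {t τ : D}

theorem IsTransversal.exists_frame (h : IsTransversal W W' φ t τ) {n : ℕ} {y : Fin n → D'}
    {Θ : MvPolynomial (Fin n) K →ₐ[K] D'} (hframe : IsCanonicalFrame W' y Θ) :
    ∃ Ψ : MvPolynomial (Fin (n + 1)) K →ₐ[K] D,
      IsCanonicalFrame W (Fin.cons t fun i => φ (y i) : Fin (n + 1) → D) Ψ ∧
      Ψ (MvPolynomial.X 0) = -τ ∧ ∀ p, Ψ (MvPolynomial.rename Fin.succ p) = φ (Θ p) := by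
  set z : Fin (n + 1) → D := Fin.cons (-τ) fun i => φ (Θ (MvPolynomial.X i)) with hz
  obtain ⟨Ψ, hΨ⟩ := exists_algHom_of_commute (K := K) z (by
    intro i j
    refine Fin.cases ?_ (fun i => ?_) i <;> refine Fin.cases ?_ (fun j => ?_) j
    · rfl
    · simp [hz, h.τ_comm]
    · simp [hz, h.τ_comm]
    · simp only [hz, Fin.cons_succ, ← map_mul, mul_comm])
  have hΨ0 : Ψ (MvPolynomial.X 0) = -τ := hΨ 0
  have hΨs : ∀ i : Fin n, Ψ (MvPolynomial.X i.succ) = φ (Θ (MvPolynomial.X i)) := fun i => hΨ i.succ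
  refine ⟨Ψ, ⟨fun i => ?_, fun i => ?_, ?_, fun i => momentum_mul_of_coords (fun i j => ?_) i⟩,
    hΨ0, fun p => ?_⟩
  · refine Fin.cases h.t_mem (fun i => ?_) i
    exact h.map_mem _ (hframe.momentum_mem i)
  · refine Fin.cases ?_ (fun i => ?_) i
    · rw [hΨ0]
      exact W.neg_mem h.τ_mem
    · rw [hΨs]
      exact h.map_mem _ (hframe.coord_mem i)
  · refine h.le_span.trans (sup_le (Submodule.span_le.mpr ?_) ?_)
    · rintro w (hw | hw | hw)
      · exact Submodule.subset_span (Or.inl (Or.inl hw))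
      · exact Submodule.subset_span (Or.inl (Or.inr ⟨0, hw.symm⟩))
      · rw [Set.mem_singleton_iff.mp hw, ← neg_neg τ, ← hΨ0]
        exact Submodule.neg_mem _ (Submodule.subset_span (Or.inr ⟨0, rfl⟩))
    · refine (Submodule.map_mono hframe.le_span).trans ?_
      rw [Submodule.map_span, Submodule.span_le]
      rintro _ ⟨_, (h | ⟨i, rfl⟩) | ⟨i, rfl⟩, rfl⟩
      · obtain rfl := Set.mem_singleton_iff.mp h
        rw [AlgHom.toLinearMap_apply, map_one]
        exact Submodule.subset_span (Or.inl (Or.inl rfl))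
      · exact Submodule.subset_span (Or.inl (Or.inr ⟨i.succ, rfl⟩))
      · exact Submodule.subset_span (Or.inr ⟨i.succ, hΨs i⟩)
  · refine Fin.cases ?_ (fun i => ?_) i <;> refine Fin.cases ?_ (fun j => ?_) j
    · rw [hΨ0, Fin.cons_zero, if_pos rfl, neg_mul, h.τ_mul_t, mul_neg]
      abel
    · rw [hΨs, Fin.cons_zero, if_neg (Fin.succ_ne_zero j).symm, h.t_comm, add_zero]
    · rw [hΨ0, Fin.cons_succ, if_neg (Fin.succ_ne_zero i), mul_neg, neg_mul, h.τ_comm, add_zero]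
    · rw [hΨs, Fin.cons_succ, ← map_mul, hframe.momentum_mul, MvPolynomial.pderiv_X, map_add,
        map_mul]
      by_cases hij : i = j
      · subst hij
        simp
      · simp [hij, Ne.symm hij]
  · have : Ψ.comp (MvPolynomial.rename Fin.succ) = φ.comp Θ :=
      MvPolynomial.algHom_ext fun i => by simp [hΨs]
    exact DFunLike.congr_fun this p

theorem IsTransversal.t_mul_pow (h : IsTransversal W W' φ t τ) (k : ℕ) :
    t * τ ^ (k + 1) = τ ^ (k + 1) * t - ((k + 1 : ℕ) : D) * τ ^ k := by
  induction k with
  | zero => simp [h.τ_mul_t]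
  | succ k ih =>
    have ht : t * τ = τ * t - 1 := by rw [h.τ_mul_t]; abel
    rw [pow_succ τ (k + 1), ← mul_assoc, ih, sub_mul, mul_assoc (τ ^ (k + 1)) t τ, ht,
      mul_assoc _ (τ ^ k), ← pow_succ, mul_sub, mul_one, mul_assoc]
    push_cast
    noncomm_ring

theorem IsTransversal.t_smul_pow {Q : Type*} [AddCommGroup Q] [Module K Q] [Module D Q]
    (h : IsTransversal W W' φ t τ) (k : ℕ)
    {q : Q} (hq : t • q = 0) :
    t • τ ^ (k + 1) • q = -((k + 1 : ℕ) : K) • τ ^ k • q := by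
  rw [smul_smul, h.t_mul_pow, sub_smul, mul_smul, hq, smul_zero, zero_sub, mul_smul, neg_smul,
    Nat.cast_smul_eq_nsmul K, Nat.cast_smul_eq_nsmul D]

variable {Q V : Type*} [AddCommGroup Q] [Module K Q] [Module D Q] [IsScalarTower K D Q]
  [AddCommGroup V] [Module K V] [Module D' V]

/-- The subspace `∑ τ^k J(P)`. -/
noncomputable def normalExtension (τ : D) (J : V →ₗ[K] Q) (P : Submodule K V) : Submodule K Q :=
  ⨆ k : ℕ, P.map (Algebra.lsmul K K Q (τ ^ k) ∘ₗ J)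

/-- `J` identifies `V` with the elements of `Q` killed by `t`. -/
structure IsNormalEmbedding (φ : D' →ₐ[K] D) (t : D) (J : V →ₗ[K] Q) : Prop where
  injective : Function.Injective J
  t_smul : ∀ v, t • J v = 0
  map_smul : ∀ w v, φ w • J v = J (w • v)

variable {J : V →ₗ[K] Q}

theorem smul_mem_normalExtension {P : Submodule K V} {v : V} (hv : v ∈ P) (k : ℕ) :
    τ ^ k • J v ∈ normalExtension τ J P :=
  Submodule.mem_iSup_of_mem k ⟨v, hv, rfl⟩

theorem mem_normalExtension {P : Submodule K V} {v : V} (hv : v ∈ P) :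
    J v ∈ normalExtension τ J P := by
  simpa using smul_mem_normalExtension (τ := τ) hv 0

theorem normalExtension_le {P : Submodule K V} {S : Submodule K Q}
    (h : ∀ k, ∀ v ∈ P, τ ^ k • J v ∈ S) : normalExtension τ J P ≤ S := by
  refine iSup_le fun k => ?_
  rintro _ ⟨v, hv, rfl⟩
  exact h k v hv

theorem exists_sum_of_mem_normalExtension {P : Submodule K V} {q : Q}
    (hq : q ∈ normalExtension τ J P) :
    ∃ (N : ℕ) (v : ℕ → V), (∀ k, v k ∈ P) ∧ q = ∑ k ∈ Finset.range N, τ ^ k • J (v k) := by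
  obtain ⟨f, hf, rfl⟩ := (Submodule.mem_iSup_iff_exists_finsupp _ _).mp hq
  choose v hv hvf using hf
  refine ⟨f.support.sup id + 1, v, hv, ?_⟩
  rw [Finsupp.sum_of_support_subset (s := Finset.range (f.support.sup id + 1)) f ?_ _
    fun _ _ => rfl]
  · exact Finset.sum_congr rfl fun k _ => (hvf k).symm
  · intro k hk
    exact Finset.mem_range_succ_iff.mpr (Finset.le_sup (f := id) hk)

theorem IsNormalEmbedding.eq_zero_of_sum_eq_zero [CharZero K] (hJ : IsNormalEmbedding φ t J)
    (h : IsTransversal W W' φ t τ) (N : ℕ) (v : ℕ → V)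
    (hv : ∑ k ∈ Finset.range N, τ ^ k • J (v k) = 0) : ∀ k < N, v k = 0 := by
  induction N generalizing v with
  | zero => simp
  | succ N ih =>
    have hsucc : ∀ k < N, v (k + 1) = 0 := by
      intro k hk
      have h1 : ∑ k ∈ Finset.range N, τ ^ k • J (-((k + 1 : ℕ) : K) • v (k + 1)) = 0 := by
        rw [← smul_zero t, ← hv, Finset.sum_range_succ', smul_add, pow_zero, one_smul, hJ.t_smul,
          add_zero, Finset.smul_sum]
        refine Finset.sum_congr rfl fun k _ => ?_
        rw [h.t_smul_pow k (hJ.t_smul _), J.map_smul, smul_comm]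
      exact (smul_eq_zero.mp (ih _ h1 k hk)).resolve_left
        (neg_ne_zero.mpr (Nat.cast_ne_zero.mpr k.succ_ne_zero))
    rw [Finset.sum_range_succ', Finset.sum_eq_zero, zero_add, pow_zero, one_smul] at hv
    · rintro (_ | k) hk
      · exact hJ.injective (by rw [hv, map_zero])
      · exact hsucc k (by omega)
    · intro k hk
      rw [hsucc k (Finset.mem_range.mp hk), map_zero, smul_zero]

theorem IsNormalEmbedding.mem_of_mem_normalExtension [CharZero K] (hJ : IsNormalEmbedding φ t J)
    (h : IsTransversal W W' φ t τ) {P : Submodule K V} {u : V}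
    (hu : J u ∈ normalExtension τ J P) : u ∈ P := by
  obtain ⟨N, v, hv, hsum⟩ := exists_sum_of_mem_normalExtension hu
  have h1 : ∑ k ∈ Finset.range (N + 1), τ ^ k • J ((if k < N then v k else 0) -
      if k = 0 then u else 0) = 0 := by
    have hu' : ∑ k ∈ Finset.range (N + 1), τ ^ k • J (if k = 0 then u else 0) = J u := by
      rw [Finset.sum_eq_single_of_mem 0 (by simp) fun k _ hk => by
        rw [if_neg hk, map_zero, smul_zero], if_pos rfl, pow_zero, one_smul]
    simp only [map_sub, smul_sub, Finset.sum_sub_distrib]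
    rw [hu', sub_eq_zero, Finset.sum_range_succ, if_neg (lt_irrefl N), map_zero, smul_zero,
      add_zero, hsum]
    exact Finset.sum_congr rfl fun k hk => by rw [if_pos (Finset.mem_range.mp hk)]
  have h2 := hJ.eq_zero_of_sum_eq_zero h _ _ h1 0 (Nat.succ_pos N)
  rw [if_pos rfl, sub_eq_zero] at h2
  rw [← h2]
  split_ifs
  · exact hv 0
  · exact P.zero_mem

theorem IsNormalEmbedding.normalExtension_range_orbitMap [IsScalarTower K D' V] (hJ : IsNormalEmbedding φ t J)
    (h : IsTransversal W W' φ t τ) {n : ℕ} {Θ : MvPolynomial (Fin n) K →ₐ[K] D'}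
    {Ψ : MvPolynomial (Fin (n + 1)) K →ₐ[K] D} (hΨ : Ψ (MvPolynomial.X 0) = -τ)
    (hΨΘ : ∀ p, Ψ (MvPolynomial.rename Fin.succ p) = φ (Θ p)) (u : V) :
    normalExtension τ J (LinearMap.range (orbitMap Θ u)) =
      LinearMap.range (orbitMap Ψ (J u)) := by
  apply le_antisymm
  · refine normalExtension_le fun k => ?_
    rintro _ ⟨p, rfl⟩
    refine ⟨(-MvPolynomial.X 0) ^ k * MvPolynomial.rename Fin.succ p, ?_⟩
    rw [orbitMap_apply, map_mul, map_pow, map_neg, hΨ, neg_neg, hΨΘ, mul_smul, hJ.map_smul,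
      orbitMap_apply]
  · rintro _ ⟨p, rfl⟩
    rw [orbitMap_apply]
    induction p using MvPolynomial.induction_on with
    | C a =>
      rw [← MvPolynomial.algebraMap_eq, AlgHom.commutes, algebraMap_smul]
      exact Submodule.smul_mem _ a (mem_normalExtension ⟨1, by simp⟩)
    | add p q hp hq =>
      rw [map_add, add_smul]
      exact add_mem hp hq
    | mul_X p j hp =>
      rw [mul_comm, map_mul, mul_smul]
      refine Fin.cases ?_ (fun j => ?_) j
      · rw [hΨ, neg_smul]
        refine neg_mem ?_
        have : normalExtension τ J (LinearMap.range (orbitMap Θ u)) ≤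
            (normalExtension τ J (LinearMap.range (orbitMap Θ u))).comap
              (Algebra.lsmul K K Q τ) := by
          refine normalExtension_le fun k v hv => ?_
          rw [Submodule.mem_comap, Algebra.lsmul_apply, smul_smul, ← pow_succ']
          exact smul_mem_normalExtension hv _
        exact this hp
      · rw [← MvPolynomial.rename_X, hΨΘ]
        have : normalExtension τ J (LinearMap.range (orbitMap Θ u)) ≤
            (normalExtension τ J (LinearMap.range (orbitMap Θ u))).comap
              (Algebra.lsmul K K Q (φ (Θ (MvPolynomial.X j)))) := by
          refine normalExtension_le fun k => ?_
          rintro _ ⟨p, rfl⟩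
          rw [Submodule.mem_comap, Algebra.lsmul_apply, smul_smul,
            ← (show Commute τ _ from h.τ_comm (Θ (MvPolynomial.X j))).pow_left k, mul_smul,
            hJ.map_smul, orbitMap_apply, smul_smul, ← map_mul]
          exact smul_mem_normalExtension (LinearMap.mem_range_self (orbitMap Θ u) _) _
        exact this hp

theorem normalExtension_bot : normalExtension τ J ⊥ = ⊥ := by
  rw [eq_bot_iff]
  refine normalExtension_le fun k v hv => ?_
  rw [(Submodule.mem_bot K).mp hv, map_zero, smul_zero]
  exact Submodule.zero_mem _

theorem IsNormalEmbedding.normalExtension_top [CharZero K] (hJ : IsNormalEmbedding φ t J)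
    (h : IsTransversal W W' φ t τ) (hker : ∀ q, t • q = 0 → ∃ v, J v = q)
    (htors : ∀ q : Q, ∃ k : ℕ, t ^ k • q = 0) : normalExtension τ J ⊤ = ⊤ := by
  rw [eq_top_iff]
  rintro q -
  obtain ⟨k, hk⟩ := htors q
  induction k generalizing q with
  | zero =>
    rw [pow_zero, one_smul] at hk
    rw [hk]
    exact Submodule.zero_mem _
  | succ k ih =>
    rw [pow_succ, mul_smul] at hk
    obtain ⟨N, v, -, hv⟩ := exists_sum_of_mem_normalExtension (ih hk)
    set r : Q := ∑ k ∈ Finset.range N, τ ^ (k + 1) • J ((-((k + 1 : ℕ) : K))⁻¹ • v k) with hr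
    have hrmem : r ∈ normalExtension τ J ⊤ :=
      Submodule.sum_mem _ fun k _ => smul_mem_normalExtension Submodule.mem_top _
    obtain ⟨w, hw⟩ := hker (q - r) (by
      rw [smul_sub, hv, hr, Finset.smul_sum, sub_eq_zero]
      refine Finset.sum_congr rfl fun k _ => ?_
      rw [h.t_smul_pow k (hJ.t_smul _), J.map_smul, smul_comm (τ ^ k), smul_smul,
        mul_inv_cancel₀ (neg_ne_zero.mpr (Nat.cast_ne_zero.mpr k.succ_ne_zero)), one_smul])
    rw [← sub_add_cancel q r, ← hw]
    exact add_mem (mem_normalExtension Submodule.mem_top) hrmem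

theorem CanonicalChain.normalExtension [CharZero K] [IsScalarTower K D' V] {n : ℕ} {N P : Submodule K V} {ℓ : ℕ}
    (hchain : CanonicalChain W' n N P ℓ) (hJ : IsNormalEmbedding φ t J)
    (h : IsTransversal W W' φ t τ) :
    CanonicalChain W (n + 1) (normalExtension τ J N) (normalExtension τ J P) ℓ := by
  induction hchain with
  | refl => exact refl _
  | @step P ℓ y Θ u hNP hframe hu hy ih =>
    obtain ⟨Ψ, hΨframe, hΨ, hΨΘ⟩ := h.exists_frame hframe
    have hsup : _root_.normalExtension τ J (P ⊔ LinearMap.range (orbitMap Θ u)) =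
        _root_.normalExtension τ J P ⊔ LinearMap.range (orbitMap Ψ (J u)) := by
      rw [← hJ.normalExtension_range_orbitMap h hΨ hΨΘ]
      simp only [_root_.normalExtension, Submodule.map_sup, iSup_sup_eq]
    rw [hsup]
    refine ih.step hΨframe (fun hmem => hu (hJ.mem_of_mem_normalExtension h hmem)) fun i => ?_
    refine Fin.cases ?_ (fun i => ?_) i
    · rw [Fin.cons_zero, hJ.t_smul]
      exact Submodule.zero_mem _
    · rw [Fin.cons_succ, hJ.map_smul]
      exact mem_normalExtension (hy i)

end NormalCrossing

section Residues

variable {K D D' : Type*} [Field K] [Ring D] [Algebra K D] [Ring D'] [Algebra K D']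
  {W : Submodule K D} {W' : Submodule K D'} {φ : D' →ₐ[K] D} {t τ : D}
  {L L' V : Type*} [AddCommGroup L] [Module K L] [Module D L] [IsScalarTower K D L]
  [AddCommGroup L'] [Module K L'] [Module D L'] [IsScalarTower K D L']
  [AddCommGroup V] [Module K V] [Module D' V] [IsScalarTower K D' V]

/-- The restriction `ev : L' → V` is the cokernel of `t`, the localization `ι : L' → L` makes `t`
bijective, and `J = t⁻¹ ι`. -/
structure IsResidueDatum (φ : D' →ₐ[K] D) (t : D) (ι : L' →ₗ[D] L) (ev : L' →ₗ[K] V)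
    (J : L' →ₗ[K] L) : Prop where
  ι_injective : Function.Injective ι
  t_injective : ∀ m : L, t • m = 0 → m = 0
  torsion : ∀ m : L, ∃ (k : ℕ) (a : L'), t ^ k • m = ι a
  t_smul_J : ∀ a, t • J a = ι a
  map_smul_J : ∀ w a, φ w • J a = J (φ w • a)
  ev_surjective : Function.Surjective ev
  ev_t_smul : ∀ a, ev (t • a) = 0
  ev_map_smul : ∀ w a, ev (φ w • a) = w • ev a
  exists_of_ev_eq_zero : ∀ a, ev a = 0 → ∃ b, a = t • b

theorem IsResidueDatum.chain [CharZero K] {ι : L' →ₗ[D] L} {ev : L' →ₗ[K] V} {J : L' →ₗ[K] L}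
    (hd : IsResidueDatum φ t ι ev J) (h : IsTransversal W W' φ t τ) {n ℓ : ℕ}
    (hchain : CanonicalChain W' n (⊥ : Submodule K V) ⊤ ℓ) :
    CanonicalChain W (n + 1) (LinearMap.range (ι.restrictScalars K)) ⊤ ℓ := by
  set π := (LinearMap.range ι).mkQ with hπ
  have hπ0 : ∀ {m}, π m = 0 ↔ ∃ a, ι a = m := Submodule.Quotient.mk_eq_zero _
  have hπs : Function.Surjective π := (LinearMap.range ι).mkQ_surjective
  have hker : LinearMap.ker ev ≤ LinearMap.ker ((π.restrictScalars K) ∘ₗ J) := by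
    intro a ha
    obtain ⟨b, rfl⟩ := hd.exists_of_ev_eq_zero a ha
    refine hπ0.mpr ⟨b, sub_eq_zero.mp (hd.t_injective _ ?_)⟩
    rw [smul_sub, hd.t_smul_J, map_smul, sub_self]
  set Jbar := ((LinearMap.ker ev).liftQ _ hker) ∘ₗ
    (ev.quotKerEquivOfSurjective hd.ev_surjective).symm.toLinearMap with hJbar
  have hJev : ∀ a, Jbar (ev a) = π (J a) := by
    intro a
    have : (ev.quotKerEquivOfSurjective hd.ev_surjective).symm (ev a) =
        (LinearMap.ker ev).mkQ a := by
      rw [LinearEquiv.symm_apply_eq]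
      rfl
    rw [hJbar, LinearMap.comp_apply, LinearEquiv.coe_coe, this]
    rfl
  have hemb : IsNormalEmbedding φ t Jbar := by
    refine ⟨?_, fun v => ?_, fun w v => ?_⟩
    · rw [injective_iff_map_eq_zero]
      intro v hv
      obtain ⟨a, rfl⟩ := hd.ev_surjective v
      rw [hJev, hπ0] at hv
      obtain ⟨b, hb⟩ := hv
      have : a = t • b := hd.ι_injective (by rw [map_smul, hb, hd.t_smul_J])
      rw [this, hd.ev_t_smul]
    · obtain ⟨a, rfl⟩ := hd.ev_surjective v
      rw [hJev, ← map_smul, hd.t_smul_J]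
      exact hπ0.mpr ⟨a, rfl⟩
    · obtain ⟨a, rfl⟩ := hd.ev_surjective v
      rw [hJev, ← map_smul, hd.map_smul_J, ← hd.ev_map_smul, hJev]
  have htop : normalExtension τ Jbar ⊤ = ⊤ := by
    refine hemb.normalExtension_top h (fun q hq => ?_) fun q => ?_
    · obtain ⟨m, rfl⟩ := hπs q
      rw [← map_smul, hπ0] at hq
      obtain ⟨a, ha⟩ := hq
      refine ⟨ev a, ?_⟩
      rw [hJev]
      congr 1
      refine sub_eq_zero.mp (hd.t_injective _ ?_)
      rw [smul_sub, hd.t_smul_J, ha, sub_self]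
    · obtain ⟨m, rfl⟩ := hπs q
      obtain ⟨k, a, ha⟩ := hd.torsion m
      refine ⟨k, ?_⟩
      rw [← map_smul, ha]
      exact hπ0.mpr ⟨a, rfl⟩
  have key := hchain.normalExtension hemb h
  rw [normalExtension_bot, htop] at key
  have hres := key.comap π hπs
  convert hres using 1
  · ext m
    exact hπ0.symm
  · rw [Submodule.comap_top]

end Residues

section WeylAlgebra

variable {K : Type} [Field K] {n : ℕ}

theorem wX_mul_wX (i j : Fin n) : wX K n i * wX K n j = wX K n j * wX K n i := by
  rw [wX, wX, ← map_mul, ← map_mul]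
  exact RingQuot.mkAlgHom_rel K (WeylRel.xx i j)

theorem wD_mul_wD (i j : Fin n) : wD K n i * wD K n j = wD K n j * wD K n i := by
  rw [wD, wD, ← map_mul, ← map_mul]
  exact RingQuot.mkAlgHom_rel K (WeylRel.dd i j)

theorem wD_mul_wX (i j : Fin n) :
    wD K n i * wX K n j = wX K n j * wD K n i + if i = j then 1 else 0 := by
  have := RingQuot.mkAlgHom_rel K (WeylRel.dx (K := K) i j)
  rw [map_mul, map_add, map_mul, apply_ite (RingQuot.mkAlgHom K (WeylRel K n)), map_one,
    map_zero] at this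
  exact this

theorem exists_weyl_algHom {E : Type*} [Ring E] [Algebra K E] (x y : Fin n → E)
    (hx : ∀ i j, x i * x j = x j * x i) (hy : ∀ i j, y i * y j = y j * y i)
    (hyx : ∀ i j, y i * x j = x j * y i + if i = j then 1 else 0) :
    ∃ φ : Weyl K n →ₐ[K] E, (∀ i, φ (wX K n i) = x i) ∧ ∀ i, φ (wD K n i) = y i := by
  have hrel : ∀ ⦃a b⦄, WeylRel K n a b →
      FreeAlgebra.lift K (Sum.elim x y) a = FreeAlgebra.lift K (Sum.elim x y) b := by
    rintro _ _ (⟨i, j⟩ | ⟨i, j⟩ | ⟨i, j⟩)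
    · simp [hx i j]
    · simp [hy i j]
    · rw [map_add, apply_ite (FreeAlgebra.lift K (Sum.elim x y))]
      simp [hyx i j]
  refine ⟨RingQuot.liftAlgHom K ⟨FreeAlgebra.lift K (Sum.elim x y), hrel⟩, fun i => ?_, fun i => ?_⟩
  · rw [wX, RingQuot.liftAlgHom_mkAlgHom_apply, FreeAlgebra.lift_ι_apply, Sum.elim_inl]
  · rw [wD, RingQuot.liftAlgHom_mkAlgHom_apply, FreeAlgebra.lift_ι_apply, Sum.elim_inr]

/-- Polynomials as operators of order zero. -/
noncomputable def weylPoly (K : Type) [Field K] (n : ℕ) :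
    MvPolynomial (Fin n) K →ₐ[K] Weyl K n :=
  (exists_algHom_of_commute (K := K) (wX K n) wX_mul_wX).choose

@[simp]
theorem weylPoly_X (i : Fin n) : weylPoly K n (MvPolynomial.X i) = wX K n i :=
  (exists_algHom_of_commute (K := K) (wX K n) wX_mul_wX).choose_spec i

@[simp]
theorem weylPoly_C (a : K) : weylPoly K n (MvPolynomial.C a) = algebraMap K (Weyl K n) a := by
  rw [← MvPolynomial.algebraMap_eq, AlgHom.commutes]

theorem wD_mul_weylPoly (i : Fin n) (p : MvPolynomial (Fin n) K) :
    wD K n i * weylPoly K n p =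
      weylPoly K n p * wD K n i + weylPoly K n (MvPolynomial.pderiv i p) :=
  momentum_mul_of_coords (fun i j => by rw [weylPoly_X, wD_mul_wX]) i p

/-- The constant vector field in the direction `v` as an element of the Weyl algebra. -/
noncomputable def weylDir (v : Fin n → K) : Weyl K n := ∑ i, v i • wD K n i

/-- The derivative of a polynomial in the direction `v`. -/
noncomputable def polyDir (v : Fin n → K) :
    Derivation K (MvPolynomial (Fin n) K) (MvPolynomial (Fin n) K) :=
  ∑ i, v i • MvPolynomial.pderiv i

theorem polyDir_apply (v : Fin n → K) (p : MvPolynomial (Fin n) K) :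
    polyDir v p = ∑ i, v i • MvPolynomial.pderiv i p := by
  have := congrFun (map_sum (Derivation.coeFnAddMonoidHom (R := K)
    (A := MvPolynomial (Fin n) K) (M := MvPolynomial (Fin n) K))
    (fun i => v i • MvPolynomial.pderiv i) Finset.univ) p
  rwa [Finset.sum_apply] at this

@[simp]
theorem polyDir_X (v : Fin n → K) (i : Fin n) :
    polyDir v (MvPolynomial.X i) = MvPolynomial.C (v i) := by
  rw [polyDir_apply, Finset.sum_eq_single i]
  · rw [MvPolynomial.pderiv_X_self, MvPolynomial.smul_eq_C_mul, mul_one]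
  · intro j _ hj
    rw [MvPolynomial.pderiv_X_of_ne hj.symm, smul_zero]
  · simp

theorem weylDir_mul_weylPoly (v : Fin n → K) (p : MvPolynomial (Fin n) K) :
    weylDir v * weylPoly K n p = weylPoly K n p * weylDir v + weylPoly K n (polyDir v p) := by
  simp only [weylDir, polyDir_apply, Finset.sum_mul, Finset.mul_sum, map_sum, map_smul,
    ← Finset.sum_add_distrib, smul_mul_assoc, mul_smul_comm, wD_mul_weylPoly, smul_add]

theorem weylDir_mul_weylDir (v w : Fin n → K) :
    weylDir v * weylDir w = weylDir w * weylDir v := by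
  simp only [weylDir, Finset.sum_mul, Finset.mul_sum, smul_mul_assoc, mul_smul_comm,
    Finset.smul_sum]
  rw [Finset.sum_comm]
  exact Finset.sum_congr rfl fun i _ => Finset.sum_congr rfl fun j _ => by
    rw [wD_mul_wD, smul_comm]

theorem weylDir_mem (v : Fin n → K) : weylDir v ∈ weylLinear K n :=
  Submodule.sum_mem _ fun i _ => Submodule.smul_mem _ _ (wD_mem_weylLinear i)

/-- The affine polynomial `∑ v_i (x_i - p_i)`. -/
noncomputable def affinePoly (p v : Fin n → K) : MvPolynomial (Fin n) K :=
  ∑ i, v i • (MvPolynomial.X i - MvPolynomial.C (p i))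

@[simp]
theorem polyDir_affinePoly (w p v : Fin n → K) :
    polyDir w (affinePoly p v) = MvPolynomial.C (∑ i, v i * w i) := by
  simp [affinePoly, map_sum, MvPolynomial.smul_eq_C_mul]

theorem weylPoly_affinePoly_mem (p v : Fin n → K) :
    weylPoly K n (affinePoly p v) ∈ weylLinear K n := by
  rw [affinePoly, map_sum]
  refine Submodule.sum_mem _ fun i _ => ?_
  rw [map_smul, map_sub, weylPoly_X, weylPoly_C, Algebra.algebraMap_eq_smul_one]
  exact Submodule.smul_mem _ _ (sub_mem (wX_mem_weylLinear i)
    (Submodule.smul_mem _ _ one_mem_weylLinear))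

end WeylAlgebra

section AffineCharts

variable {K : Type} [Field K] {n : ℕ}

/-- Linear algebra data exhibiting `ρ` as the restriction to the hyperplane through `p` with
conormal `c`, parametrized by `y ↦ p + J y`; the vector `a` is transversal to it and the
functionals `b` are dual to `J` and vanish on `a`. -/
structure IsAffineChart (h : MvPolynomial (Fin (n + 1)) K)
    (ρ : MvPolynomial (Fin (n + 1)) K →ₐ[K] MvPolynomial (Fin n) K)
    (p c a : Fin (n + 1) → K) (J b : Fin n → Fin (n + 1) → K) : Prop where
  h_eq : h = affinePoly p c
  ρ_X : ∀ i, ρ (MvPolynomial.X i) = MvPolynomial.C (p i) + ∑ k, J k i • MvPolynomial.X k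
  c_a : ∑ i, c i * a i = 1
  c_J : ∀ k, ∑ i, c i * J k i = 0
  b_a : ∀ j, ∑ i, b j i * a i = 0
  b_J : ∀ j k, ∑ i, b j i * J k i = if j = k then 1 else 0
  complete : ∀ i m, a i * c m + ∑ k, J k i * b k m = if i = m then 1 else 0

variable {h : MvPolynomial (Fin (n + 1)) K}
  {ρ : MvPolynomial (Fin (n + 1)) K →ₐ[K] MvPolynomial (Fin n) K}
  {p c a : Fin (n + 1) → K} {J b : Fin n → Fin (n + 1) → K}

theorem exists_isAffineChart (hh : h = affinePoly p c) (hc : c ≠ 0) (hρh : ρ h = 0)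
    (hρ : ∀ i, ρ (MvPolynomial.X i) = MvPolynomial.C (p i) + ∑ k, J k i • MvPolynomial.X k)
    (hbJ : ∀ j k, ∑ i, b j i * J k i = if j = k then 1 else 0) :
    ∃ a b', IsAffineChart h ρ p c a J b' := by
  obtain ⟨i₀, hi₀⟩ := Function.ne_iff.mp hc
  set a : Fin (n + 1) → K := Pi.single i₀ (c i₀)⁻¹ with ha
  have hca : ∑ i, c i * a i = 1 := by
    rw [Finset.sum_eq_single i₀ (fun j _ hj => by rw [ha, Pi.single_eq_of_ne hj, mul_zero])
      (by simp), ha, Pi.single_eq_same]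
    exact mul_inv_cancel₀ hi₀
  have hcJ : ∀ k, ∑ i, c i * J k i = 0 := by
    intro k
    have h1 := congrArg (polyDir (Pi.single k 1)) hρh
    rw [hh, affinePoly, map_sum, map_sum, map_zero] at h1
    simp only [map_smul, map_sub, hρ, AlgHom.commutes, ← MvPolynomial.algebraMap_eq,
      add_sub_cancel_left] at h1
    simp only [map_sum, Derivation.map_smul, polyDir_X] at h1
    simp only [MvPolynomial.smul_eq_C_mul, ← map_mul, ← map_sum] at h1
    rw [MvPolynomial.C_eq_zero] at h1
    simpa [Pi.single_apply] using h1
  set b' : Fin n → Fin (n + 1) → K := fun j i => b j i - (∑ l, b j l * a l) * c i with hb'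
  have hba : ∀ j, ∑ i, b' j i * a i = 0 := by
    intro j
    simp only [hb', sub_mul, Finset.sum_sub_distrib, mul_assoc, ← Finset.mul_sum, hca, mul_one,
      sub_self]
  have hbJ' : ∀ j k, ∑ i, b' j i * J k i = if j = k then 1 else 0 := by
    intro j k
    simp only [hb', sub_mul, Finset.sum_sub_distrib, mul_assoc, ← Finset.mul_sum, hcJ, mul_zero,
      sub_zero, hbJ]
  refine ⟨a, b', hh, hρ, hca, hcJ, hba, hbJ', fun i m => ?_⟩
  let P : Matrix (Fin (n + 1)) (Fin (n + 1)) K := Matrix.of (Fin.cons c b')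
  let Q : Matrix (Fin (n + 1)) (Fin (n + 1)) K := (Matrix.of (Fin.cons a J)).transpose
  have hPQ : P * Q = 1 := by
    ext i j
    rw [Matrix.mul_apply, Matrix.one_apply]
    refine Fin.cases ?_ (fun i => ?_) i <;> refine Fin.cases ?_ (fun j => ?_) j
    · simpa [P, Q] using hca
    · simpa [P, Q, (Fin.succ_ne_zero j).symm] using hcJ j
    · simpa [P, Q] using hba i
    · simpa [P, Q] using hbJ' i j
  have hQP' : Q * P = 1 := mul_eq_one_comm.mp hPQ
  have hQP := congrFun (congrFun hQP' i) m
  rw [Matrix.mul_apply, Matrix.one_apply, Fin.sum_univ_succ] at hQP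
  simpa [P, Q] using hQP

namespace IsAffineChart

theorem X_eq (hd : IsAffineChart h ρ p c a J b) (i : Fin (n + 1)) :
    (MvPolynomial.X i : MvPolynomial (Fin (n + 1)) K) =
      MvPolynomial.C (p i) + a i • h + ∑ k, J k i • affinePoly p (b k) := by
  have h1 : a i • h + ∑ k, J k i • affinePoly p (b k) =
      ∑ m, (a i * c m + ∑ k, J k i * b k m) • (MvPolynomial.X m - MvPolynomial.C (p m)) := by
    simp only [hd.h_eq, affinePoly, Finset.smul_sum, smul_smul, add_smul, Finset.sum_add_distrib,
      Finset.sum_smul]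
    rw [Finset.sum_comm]
  rw [add_assoc, h1]
  simp [hd.complete]

theorem ρ_affinePoly (hd : IsAffineChart h ρ p c a J b) (v : Fin (n + 1) → K) :
    ρ (affinePoly p v) = ∑ k, (∑ i, v i * J k i) • MvPolynomial.X k := by
  rw [affinePoly, map_sum]
  simp only [map_smul, map_sub, hd.ρ_X, ← MvPolynomial.algebraMap_eq, AlgHom.commutes,
    add_sub_cancel_left, Finset.smul_sum, smul_smul, Finset.sum_smul]
  rw [Finset.sum_comm]

theorem ρ_h (hd : IsAffineChart h ρ p c a J b) : ρ h = 0 := by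
  simp [hd.h_eq, hd.ρ_affinePoly, hd.c_J]

theorem ρ_coord (hd : IsAffineChart h ρ p c a J b) (j : Fin n) :
    ρ (affinePoly p (b j)) = MvPolynomial.X j := by
  simp [hd.ρ_affinePoly, hd.b_J]

theorem ρ_surjective (hd : IsAffineChart h ρ p c a J b) : Function.Surjective ρ := by
  rw [← AlgHom.range_eq_top, ← top_le_iff, ← MvPolynomial.adjoin_range_X, Algebra.adjoin_le_iff]
  rintro _ ⟨j, rfl⟩
  exact ⟨_, hd.ρ_coord j⟩

theorem dvd_of_ρ_eq_zero (hd : IsAffineChart h ρ p c a J b) {q : MvPolynomial (Fin (n + 1)) K}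
    (hq : ρ q = 0) : h ∣ q := by
  set σ : MvPolynomial (Fin n) K →ₐ[K] MvPolynomial (Fin (n + 1)) K :=
    MvPolynomial.aeval fun j => affinePoly p (b j)
  have key : (Ideal.Quotient.mkₐ K (Ideal.span {h})) =
      ((Ideal.Quotient.mkₐ K (Ideal.span {h})).comp σ).comp ρ := by
    refine MvPolynomial.algHom_ext fun i => ?_
    rw [AlgHom.comp_apply, AlgHom.comp_apply, hd.ρ_X, hd.X_eq i]
    simp only [map_add, map_smul, map_sum, σ, MvPolynomial.aeval_X, MvPolynomial.algHom_C]
    rw [Ideal.Quotient.mkₐ_eq_mk, (Ideal.Quotient.eq_zero_iff_mem).mpr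
      (Ideal.mem_span_singleton_self h), smul_zero, add_zero]
    simp only [MvPolynomial.algebraMap_eq]
    rfl
  have h1 := DFunLike.congr_fun key q
  rw [AlgHom.comp_apply, hq, map_zero] at h1
  exact Ideal.mem_span_singleton.mp ((Ideal.Quotient.eq_zero_iff_mem).mp h1)

theorem ρ_eq_zero_iff (hd : IsAffineChart h ρ p c a J b) {q : MvPolynomial (Fin (n + 1)) K} :
    ρ q = 0 ↔ h ∣ q := by
  refine ⟨hd.dvd_of_ρ_eq_zero, ?_⟩
  rintro ⟨r, rfl⟩
  rw [map_mul, hd.ρ_h, zero_mul]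

theorem ρ_polyDir (hd : IsAffineChart h ρ p c a J b) (k : Fin n)
    (q : MvPolynomial (Fin (n + 1)) K) :
    ρ (polyDir (J k) q) = MvPolynomial.pderiv k (ρ q) := by
  induction q using MvPolynomial.induction_on with
  | C r => simp
  | add p q hp hq => rw [map_add, map_add, hp, hq, map_add, map_add]
  | mul_X q i hq =>
    have hX : MvPolynomial.pderiv k (ρ (MvPolynomial.X i)) = MvPolynomial.C (J k i) := by
      rw [hd.ρ_X, map_add, MvPolynomial.pderiv_C, zero_add, map_sum, Finset.sum_eq_single k]
      · rw [Derivation.map_smul, MvPolynomial.pderiv_X_self, MvPolynomial.smul_eq_C_mul, mul_one]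
      · intro j _ hj
        rw [Derivation.map_smul, MvPolynomial.pderiv_X_of_ne hj, smul_zero]
      · simp
    rw [Derivation.leibniz, map_add, smul_eq_mul, smul_eq_mul, map_mul, map_mul, map_mul,
      Derivation.leibniz, hq, hX, polyDir_X, MvPolynomial.algHom_C, smul_eq_mul, smul_eq_mul,
      MvPolynomial.algebraMap_eq]

theorem h_ne_zero (hd : IsAffineChart h ρ p c a J b) : h ≠ 0 := by
  intro h0
  have := polyDir_affinePoly a p c
  rw [← hd.h_eq, h0, map_zero, hd.c_a, map_one] at this
  exact zero_ne_one this

theorem prime (hd : IsAffineChart h ρ p c a J b) : Prime h := by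
  rw [← Ideal.span_singleton_prime hd.h_ne_zero]
  have : Ideal.span {h} = RingHom.ker ρ := by
    ext q
    rw [Ideal.mem_span_singleton, RingHom.mem_ker, ← hd.ρ_eq_zero_iff]
  rw [this]
  exact RingHom.ker_isPrime _

theorem exists_isTransversal (hd : IsAffineChart h ρ p c a J b) :
    ∃ φ : Weyl K n →ₐ[K] Weyl K (n + 1),
      IsTransversal (weylLinear K (n + 1)) (weylLinear K n) φ (weylPoly K (n + 1) h)
        (weylDir a) ∧
      (∀ j, φ (wX K n j) = weylPoly K (n + 1) (affinePoly p (b j))) ∧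
      ∀ k, φ (wD K n k) = weylDir (J k) := by
  obtain ⟨φ, hφX, hφD⟩ := exists_weyl_algHom (K := K)
    (fun j => weylPoly K (n + 1) (affinePoly p (b j))) (fun k => weylDir (J k))
    (fun i j => by rw [← map_mul, mul_comm, map_mul]) (fun i j => weylDir_mul_weylDir _ _)
    (fun i j => by
      rw [weylDir_mul_weylPoly, polyDir_affinePoly, hd.b_J, weylPoly_C]
      by_cases hij : i = j
      · simp [hij]
      · simp [hij, Ne.symm hij])
  refine ⟨φ, ⟨?_, weylDir_mem a, fun w hw => ?_, ?_, ?_, fun w => ?_, fun w => ?_⟩, hφX, hφD⟩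
  · rw [hd.h_eq]
    exact weylPoly_affinePoly_mem p c
  · have hle : weylLinear K n ≤ (weylLinear K (n + 1)).comap φ.toLinearMap := by
      refine Submodule.span_le.mpr ?_
      rintro _ ((h | ⟨i, rfl⟩) | ⟨i, rfl⟩)
      · obtain rfl := Set.mem_singleton_iff.mp h
        rw [SetLike.mem_coe, Submodule.mem_comap, AlgHom.toLinearMap_apply, map_one]
        exact one_mem_weylLinear
      · rw [SetLike.mem_coe, Submodule.mem_comap, AlgHom.toLinearMap_apply, hφX]
        exact weylPoly_affinePoly_mem _ _
      · rw [SetLike.mem_coe, Submodule.mem_comap, AlgHom.toLinearMap_apply, hφD]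
        exact weylDir_mem _
    exact hle hw
  · refine Submodule.span_le.mpr ?_
    have hone : (1 : Weyl K (n + 1)) ∈ Submodule.span K {1, weylPoly K (n + 1) h, weylDir a} ⊔
        (weylLinear K n).map φ.toLinearMap :=
      Submodule.mem_sup_left (Submodule.subset_span (Or.inl rfl))
    rintro _ ((h | ⟨i, rfl⟩) | ⟨i, rfl⟩)
    · obtain rfl := Set.mem_singleton_iff.mp h
      exact hone
    · rw [← weylPoly_X, hd.X_eq i, map_add, map_add, map_sum, weylPoly_C,
        Algebra.algebraMap_eq_smul_one, map_smul]
      refine add_mem (add_mem (Submodule.smul_mem _ _ hone)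
        (Submodule.mem_sup_left (Submodule.smul_mem _ _ (Submodule.subset_span
          (Or.inr (Or.inl rfl)))))) (Submodule.mem_sup_right (Submodule.sum_mem _ fun k _ => ?_))
      rw [map_smul, ← hφX]
      exact Submodule.smul_mem _ _ (Submodule.mem_map_of_mem (f := φ.toLinearMap)
        (wX_mem_weylLinear k))
    · have hD : wD K (n + 1) i = c i • weylDir a + ∑ k, b k i • weylDir (J k) := by
        have h1 : c i • weylDir a + ∑ k, b k i • weylDir (J k) =
            ∑ m, (a m * c i + ∑ k, J k m * b k i) • wD K (n + 1) m := by
          simp only [weylDir, Finset.smul_sum, smul_smul, add_smul, Finset.sum_add_distrib,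
            Finset.sum_smul, mul_comm]
          rw [Finset.sum_comm (γ := Fin n)]
        rw [h1]
        simp [hd.complete]
      rw [hD]
      refine add_mem (Submodule.mem_sup_left (Submodule.smul_mem _ _ (Submodule.subset_span
          (Or.inr (Or.inr rfl))))) (Submodule.mem_sup_right (Submodule.sum_mem _ fun k _ => ?_))
      rw [← hφD]
      exact Submodule.smul_mem _ _ (Submodule.mem_map_of_mem (f := φ.toLinearMap)
        (wD_mem_weylLinear k))
  · rw [weylDir_mul_weylPoly, hd.h_eq, polyDir_affinePoly, hd.c_a, map_one, map_one]
  · induction w using weyl_induction with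
    | algebraMap r => rw [AlgHom.commutes, Algebra.commutes]
    | wX j => rw [hφX, ← map_mul, mul_comm, map_mul]
    | wD k =>
      rw [hφD, weylDir_mul_weylPoly, hd.h_eq, polyDir_affinePoly, hd.c_J, map_zero, map_zero,
        add_zero]
    | add v w hv hw => rw [map_add, mul_add, hv, hw, add_mul]
    | mul v w hv hw => rw [map_mul, ← mul_assoc, hv, mul_assoc, hw, mul_assoc]
  · induction w using weyl_induction with
    | algebraMap r => rw [AlgHom.commutes, Algebra.commutes]
    | wX j =>
      rw [hφX, weylDir_mul_weylPoly, polyDir_affinePoly, hd.b_a, map_zero, map_zero, add_zero]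
    | wD k => rw [hφD, weylDir_mul_weylDir]
    | add v w hv hw => rw [map_add, mul_add, hv, hw, add_mul]
    | mul v w hv hw => rw [map_mul, ← mul_assoc, hv, mul_assoc, hw, mul_assoc]

end IsAffineChart

end AffineCharts

section Localizations

variable {K : Type} [Field K] {n : ℕ}

theorem algebraMap_away_injective {f : MvPolynomial (Fin n) K} (hf : f ≠ 0) :
    Function.Injective (algebraMap (MvPolynomial (Fin n) K) (Localization.Away f)) :=
  IsLocalization.injective _ (powers_le_nonZeroDivisors_of_noZeroDivisors hf)

theorem isUnit_algebraMap_pow (f : MvPolynomial (Fin n) K) (k : ℕ) :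
    IsUnit (algebraMap (MvPolynomial (Fin n) K) (Localization.Away f) (f ^ k)) :=
  IsLocalization.map_units (Localization.Away f) (⟨f ^ k, k, rfl⟩ : Submonoid.powers f)

theorem isUnit_algebraMap_of_dvd {f g : MvPolynomial (Fin n) K} {k : ℕ} (h : g ∣ f ^ k) :
    IsUnit (algebraMap (MvPolynomial (Fin n) K) (Localization.Away f) g) :=
  isUnit_of_dvd_unit (map_dvd _ h) (isUnit_algebraMap_pow f k)

theorem exists_mul_pow_eq (f : MvPolynomial (Fin n) K) (m : Localization.Away f) :
    ∃ (k : ℕ) (r : MvPolynomial (Fin n) K), m * algebraMap (MvPolynomial (Fin n) K) (Localization.Away f) (f ^ k) = algebraMap _ _ r := by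
  obtain ⟨⟨r, _, k, rfl⟩, h⟩ := IsLocalization.surj (Submonoid.powers f) m
  exact ⟨k, r, h⟩

theorem exists_div_pow (f r : MvPolynomial (Fin n) K) (k : ℕ) :
    ∃ m : Localization.Away f, m * algebraMap (MvPolynomial (Fin n) K) (Localization.Away f) (f ^ k) =
      algebraMap _ _ r := by
  obtain ⟨u, hu⟩ := isUnit_algebraMap_pow f k
  exact ⟨algebraMap _ _ r * ↑u⁻¹, by rw [← hu, Units.inv_mul_cancel_right]⟩

theorem exists_localization_algHom {B : Type*} [CommRing B] [Algebra K B] (f : MvPolynomial (Fin n) K)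
    (g : MvPolynomial (Fin n) K →ₐ[K] B) (hg : IsUnit (g f)) :
    ∃ Λ : Localization.Away f →ₐ[K] B, ∀ r, Λ (algebraMap _ _ r) = g r := by
  have hu : ∀ y : Submonoid.powers f, IsUnit (g y) := by
    rintro ⟨_, k, rfl⟩
    rw [map_pow]
    exact hg.pow k
  exact ⟨IsLocalization.liftAlgHom (M := Submonoid.powers f) hu,
    fun r => IsLocalization.lift_eq _ r⟩

theorem map_derivation_eq {B : Type*} [CommRing B] [Algebra K B] {f : MvPolynomial (Fin n) K}
    (Λ : Localization.Away f →ₐ[K] B)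
    (δ : Derivation K (Localization.Away f) (Localization.Away f)) (ε : Derivation K B B)
    (h : ∀ r, Λ (δ (algebraMap (MvPolynomial (Fin n) K) _ r)) = ε (Λ (algebraMap (MvPolynomial (Fin n) K) _ r))) (m : Localization.Away f) :
    Λ (δ m) = ε (Λ m) := by
  obtain ⟨k, r, hr⟩ := exists_mul_pow_eq f m
  have h1 := congrArg Λ (congrArg δ hr)
  rw [h, ← hr, Derivation.leibniz, map_mul, Derivation.leibniz, map_add, smul_eq_mul, smul_eq_mul,
    map_mul, map_mul, h, smul_eq_mul, smul_eq_mul, add_right_inj] at h1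
  exact ((isUnit_algebraMap_pow f k).map Λ).mul_left_cancel h1

namespace NatActs

variable {f : MvPolynomial (Fin n) K} [Module (Weyl K n) (Localization.Away f)]
  [IsScalarTower K (Weyl K n) (Localization.Away f)]

theorem weylPoly_smul (hf : NatActs K n f) (p : MvPolynomial (Fin n) K) (m : Localization.Away f) :
    weylPoly K n p • m = algebraMap (MvPolynomial (Fin n) K) _ p * m := by
  induction p using MvPolynomial.induction_on generalizing m with
  | C a =>
    rw [weylPoly_C, algebraMap_smul, Algebra.smul_def, ← MvPolynomial.algebraMap_eq,
      ← IsScalarTower.algebraMap_apply]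
  | add p q hp hq => rw [map_add, add_smul, hp, hq, map_add, add_mul]
  | mul_X p i hp => rw [map_mul, mul_smul, hp, weylPoly_X, hf.1, map_mul, mul_assoc]

theorem exists_weylDir_smul (hf : NatActs K n f) (v : Fin n → K) :
    ∃ δ : Derivation K (Localization.Away f) (Localization.Away f),
      (∀ m, weylDir v • m = δ m) ∧
      ∀ r : MvPolynomial (Fin n) K, δ (algebraMap (MvPolynomial (Fin n) K) _ r) = algebraMap (MvPolynomial (Fin n) K) _ (polyDir v r) := by
  choose δ hδ hδr using hf.2
  have hsum : ∀ m, (∑ i, v i • δ i) m = ∑ i, v i • δ i m := by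
    intro m
    have := congrFun (map_sum (Derivation.coeFnAddMonoidHom (R := K)
      (A := Localization.Away f) (M := Localization.Away f)) (fun i => v i • δ i) Finset.univ) m
    rwa [Finset.sum_apply] at this
  refine ⟨∑ i, v i • δ i, fun m => ?_, fun r => ?_⟩
  · rw [hsum, weylDir, Finset.sum_smul]
    exact Finset.sum_congr rfl fun i _ => by rw [smul_assoc, hδ]
  · rw [hsum, polyDir_apply, map_sum]
    refine Finset.sum_congr rfl fun i _ => ?_
    rw [hδr, MvPolynomial.smul_eq_C_mul, map_mul, Algebra.smul_def, ← MvPolynomial.algebraMap_eq,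
      ← IsScalarTower.algebraMap_apply]

theorem weyl_smul_eq {f g : MvPolynomial (Fin n) K} [Module (Weyl K n) (Localization.Away f)]
    [IsScalarTower K (Weyl K n) (Localization.Away f)] (hf : NatActs K n f)
    [Module (Weyl K n) (Localization.Away g)]
    [IsScalarTower K (Weyl K n) (Localization.Away g)] (hg : NatActs K n g)
    (Λ : Localization.Away f →ₐ[K] Localization.Away g)
    (hΛ : ∀ r : MvPolynomial (Fin n) K, Λ (algebraMap _ _ r) = algebraMap _ _ r) (w : Weyl K n) (m : Localization.Away f) :
    Λ (w • m) = w • Λ m := by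
  induction w using weyl_induction generalizing m with
  | algebraMap a => rw [algebraMap_smul, algebraMap_smul, map_smul]
  | wX i => rw [hf.1, hg.1, map_mul, hΛ]
  | wD i =>
    obtain ⟨δ, hδ, hδr⟩ := hf.2 i
    obtain ⟨ε, hε, hεr⟩ := hg.2 i
    rw [hδ, hε]
    exact map_derivation_eq Λ δ ε (fun r => by rw [hδr, hΛ, hΛ, hεr]) m
  | add v w hv hw => rw [add_smul, add_smul, map_add, hv, hw]
  | mul v w hv hw => rw [mul_smul, mul_smul, hv, hw]

theorem exists_linearMap {f g : MvPolynomial (Fin n) K} [Module (Weyl K n) (Localization.Away f)]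
    [IsScalarTower K (Weyl K n) (Localization.Away f)] (hf : NatActs K n f)
    [Module (Weyl K n) (Localization.Away g)]
    [IsScalarTower K (Weyl K n) (Localization.Away g)] (hg : NatActs K n g) (hg0 : g ≠ 0)
    {k : ℕ} (hdvd : f ∣ g ^ k) :
    ∃ ι : Localization.Away f →ₗ[Weyl K n] Localization.Away g, Function.Injective ι ∧
      (∀ r : MvPolynomial (Fin n) K, ι (algebraMap _ _ r) = algebraMap _ _ r) ∧ ∀ x y, ι (x * y) = ι x * ι y := by
  obtain ⟨Λ, hΛ⟩ := exists_localization_algHom f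
    (IsScalarTower.toAlgHom K (MvPolynomial (Fin n) K) (Localization.Away g)) (isUnit_algebraMap_of_dvd hdvd)
  refine ⟨{ Λ.toLinearMap with map_smul' := hf.weyl_smul_eq hg Λ hΛ }, ?_, hΛ, map_mul Λ⟩
  have hinj : Function.Injective Λ := by
    rw [injective_iff_map_eq_zero]
    intro m hm
    obtain ⟨k, r, hr⟩ := exists_mul_pow_eq f m
    have h1 := congrArg Λ hr
    rw [map_mul, hm, zero_mul, hΛ] at h1
    have hr0 : r = 0 := algebraMap_away_injective hg0 (by rw [map_zero]; exact h1.symm)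
    rw [hr0, map_zero] at hr
    exact (isUnit_algebraMap_pow f k).mul_left_eq_zero.mp hr
  exact hinj

theorem map_polyRange {f g : MvPolynomial (Fin n) K} [Module (Weyl K n) (Localization.Away f)]
    [IsScalarTower K (Weyl K n) (Localization.Away f)]
    [Module (Weyl K n) (Localization.Away g)]
    [IsScalarTower K (Weyl K n) (Localization.Away g)]
    {ι : Localization.Away f →ₗ[Weyl K n] Localization.Away g}
    (hι : ∀ r : MvPolynomial (Fin n) K, ι (algebraMap _ _ r) = algebraMap _ _ r) :
    (polyRange f).map (ι.restrictScalars K) = polyRange g := by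
  rw [polyRange, ← LinearMap.range_comp]
  congr 1
  exact LinearMap.ext hι

theorem chain_map {f g : MvPolynomial (Fin n) K} [Module (Weyl K n) (Localization.Away f)]
    [IsScalarTower K (Weyl K n) (Localization.Away f)] (hf : NatActs K n f)
    [Module (Weyl K n) (Localization.Away g)]
    [IsScalarTower K (Weyl K n) (Localization.Away g)] (hg : NatActs K n g) (hg0 : g ≠ 0)
    {k j : ℕ} (hdvd : f ∣ g ^ k) (hdvd' : g ∣ f ^ j) {ℓ : ℕ}
    (h : CanonicalChain (weylLinear K n) n (polyRange f) ⊤ ℓ) :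
    CanonicalChain (weylLinear K n) n (polyRange g) ⊤ ℓ := by
  obtain ⟨ι, hinj, hι, hmul⟩ := hf.exists_linearMap hg hg0 hdvd
  have hchain := h.map ι fun m hm => by
    rw [hinj (hm.trans (map_zero ι).symm)]
    exact Submodule.zero_mem _
  rw [map_polyRange hι] at hchain
  convert hchain
  rw [eq_comm, Submodule.map_top, LinearMap.range_eq_top]
  intro y
  obtain ⟨i, r, hr⟩ := exists_mul_pow_eq g y
  obtain ⟨s, hs⟩ := pow_dvd_pow_of_dvd hdvd' i
  rw [← pow_mul] at hs
  obtain ⟨x, hx⟩ := exists_div_pow f (r * s) (j * i)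
  have hιx : ι x * algebraMap _ _ (f ^ (j * i)) = algebraMap _ _ (r * s) := by
    rw [← hι, ← hmul, hx, hι]
  have hunit : IsUnit (algebraMap _ (Localization.Away g) (f ^ (j * i))) := by
    rw [map_pow]
    exact (isUnit_algebraMap_of_dvd hdvd).pow _
  refine ⟨x, hunit.mul_right_cancel ?_⟩
  rw [LinearMap.restrictScalars_apply, hιx, map_mul, ← hr, hs, map_mul, mul_assoc]

theorem chain_polyRange (hf : NatActs K n f) (hf0 : f ≠ 0) :
    CanonicalChain (weylLinear K n) n ⊥ (polyRange f) 1 := by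
  have hframe : IsCanonicalFrame (weylLinear K n) (wD K n) (weylPoly K n) :=
    ⟨wD_mem_weylLinear, fun i => by rw [weylPoly_X]; exact wX_mem_weylLinear i, by
      refine Submodule.span_mono ?_
      rintro w ((h | ⟨i, rfl⟩) | h)
      · exact Or.inl (Or.inl h)
      · exact Or.inr ⟨i, weylPoly_X i⟩
      · exact Or.inl (Or.inr h), wD_mul_weylPoly⟩
  have hnontriv : (1 : Localization.Away f) ≠ 0 := by
    intro h1
    refine one_ne_zero (α := MvPolynomial (Fin n) K) (algebraMap_away_injective hf0 ?_)
    rw [map_one, map_zero, h1]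
  have := (CanonicalChain.refl (W := weylLinear K n) (n := n)
    (⊥ : Submodule K (Localization.Away f))).step hframe (u := 1) hnontriv fun i => by
      obtain ⟨δ, hδ, -⟩ := hf.2 i
      rw [hδ, Derivation.map_one_eq_zero]
      exact Submodule.zero_mem _
  convert this using 1
  rw [bot_sup_eq, polyRange]
  congr 1
  refine LinearMap.ext fun r => ?_
  rw [orbitMap_apply, hf.weylPoly_smul, mul_one]
  rfl

end NatActs

end Localizations

section DeletionRestriction

variable {K : Type} [Field K] {n : ℕ}
  {h : MvPolynomial (Fin (n + 1)) K}
  {ρ : MvPolynomial (Fin (n + 1)) K →ₐ[K] MvPolynomial (Fin n) K}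
  {p c a : Fin (n + 1) → K} {J b : Fin n → Fin (n + 1) → K}
  {f f' : MvPolynomial (Fin (n + 1)) K} {g : MvPolynomial (Fin n) K}

theorem IsAffineChart.exists_isResidueDatum (hd : IsAffineChart h ρ p c a J b)
    (hf : f = h * f') (hg0 : g ≠ 0) {j k : ℕ} (hgf : g ∣ ρ f' ^ j)
    (hfg : ρ f' ∣ g ^ k)
    [Module (Weyl K (n + 1)) (Localization.Away f)]
    [IsScalarTower K (Weyl K (n + 1)) (Localization.Away f)] (hnatf : NatActs K (n + 1) f)
    [Module (Weyl K (n + 1)) (Localization.Away f')]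
    [IsScalarTower K (Weyl K (n + 1)) (Localization.Away f')] (hnatf' : NatActs K (n + 1) f')
    [Module (Weyl K n) (Localization.Away g)]
    [IsScalarTower K (Weyl K n) (Localization.Away g)] (hnatg : NatActs K n g)
    {φ : Weyl K n →ₐ[K] Weyl K (n + 1)}
    (hφ : IsTransversal (weylLinear K (n + 1)) (weylLinear K n) φ (weylPoly K (n + 1) h)
      (weylDir a))
    (hφX : ∀ j, φ (wX K n j) = weylPoly K (n + 1) (affinePoly p (b j)))
    (hφD : ∀ k, φ (wD K n k) = weylDir (J k))
    {ι : Localization.Away f' →ₗ[Weyl K (n + 1)] Localization.Away f}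
    (hinj : Function.Injective ι) (hι : ∀ r : MvPolynomial (Fin (n + 1)) K, ι (algebraMap _ _ r) = algebraMap _ _ r)
    (hmul : ∀ x y, ι (x * y) = ι x * ι y) :
    ∃ (ev : Localization.Away f' →ₗ[K] Localization.Away g)
      (T : Localization.Away f' →ₗ[K] Localization.Away f),
      IsResidueDatum φ (weylPoly K (n + 1) h) ι ev T := by
  have hunit : IsUnit (algebraMap _ (Localization.Away f) h) :=
    isUnit_algebraMap_of_dvd (k := 1) (by rw [pow_one, hf]; exact dvd_mul_right _ _)
  have htinj : ∀ m : Localization.Away f, weylPoly K (n + 1) h • m = 0 → m = 0 := by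
    intro m hm
    rw [hnatf.weylPoly_smul] at hm
    exact hunit.mul_right_eq_zero.mp hm
  obtain ⟨Λ, hΛ⟩ := exists_localization_algHom f'
    ((IsScalarTower.toAlgHom K _ (Localization.Away g)).comp ρ) (isUnit_algebraMap_of_dvd hfg)
  replace hΛ : ∀ r : MvPolynomial (Fin (n + 1)) K, Λ (algebraMap _ _ r) = algebraMap _ _ (ρ r) := hΛ
  obtain ⟨u, hu⟩ := hunit
  have htJ : ∀ x : Localization.Away f',
      weylPoly K (n + 1) h • ((u⁻¹ : (Localization.Away f)ˣ) * ι x) = ι x := by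
    intro x
    rw [hnatf.weylPoly_smul, ← hu, Units.mul_inv_cancel_left]
  refine ⟨Λ.toLinearMap, LinearMap.mulLeft K (u⁻¹ : (Localization.Away f)ˣ) ∘ₗ
    ι.restrictScalars K, hinj, htinj, fun m => ?_, htJ, fun w x => ?_, fun y => ?_, fun x => ?_,
    fun w x => ?_, fun x hx => ?_⟩
  · obtain ⟨i, r, hr⟩ := exists_mul_pow_eq f m
    obtain ⟨x, hx⟩ := exists_div_pow f' r i
    refine ⟨i, x, (isUnit_algebraMap_of_dvd (k := i) (f := f) (g := f' ^ i)
      (pow_dvd_pow_of_dvd (by rw [hf]; exact dvd_mul_left _ _) i)).mul_right_cancel ?_⟩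
    have hfi : algebraMap _ (Localization.Away f) (f ^ i) =
        algebraMap _ _ (h ^ i) * algebraMap _ _ (f' ^ i) := by
      rw [← map_mul, ← mul_pow, ← hf]
    rw [← hι, ← hmul, hx, hι, hι, ← map_pow, hnatf.weylPoly_smul, ← hr, hfi]
    ring
  · refine sub_eq_zero.mp (htinj _ ?_)
    rw [smul_sub, smul_smul, hφ.t_comm, mul_smul]
    simp only [LinearMap.comp_apply, LinearMap.restrictScalars_apply, LinearMap.mulLeft_apply]
    rw [htJ, htJ, map_smul, sub_self]
  · obtain ⟨i, r, hr⟩ := exists_mul_pow_eq g y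
    obtain ⟨s, hs⟩ := pow_dvd_pow_of_dvd hgf i
    obtain ⟨q, hq⟩ := hd.ρ_surjective (r * s)
    obtain ⟨x, hx⟩ := exists_div_pow f' q (j * i)
    refine ⟨x, ((isUnit_algebraMap_pow f' (j * i)).map Λ).mul_right_cancel ?_⟩
    rw [AlgHom.toLinearMap_apply, ← map_mul, hx, hΛ, hq, hΛ, map_pow, pow_mul, hs, map_mul,
      ← hr, map_mul, mul_assoc]
  · rw [AlgHom.toLinearMap_apply, hnatf'.weylPoly_smul, map_mul, hΛ, hd.ρ_h, map_zero, zero_mul]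
  · rw [AlgHom.toLinearMap_apply, AlgHom.toLinearMap_apply]
    induction w using weyl_induction generalizing x with
    | algebraMap r => rw [AlgHom.commutes, algebraMap_smul, algebraMap_smul, map_smul]
    | wX i => rw [hφX, hnatf'.weylPoly_smul, map_mul, hΛ, hd.ρ_coord, hnatg.1]
    | wD i =>
      obtain ⟨δ, hδ, hδr⟩ := hnatf'.exists_weylDir_smul (J i)
      obtain ⟨ε, hε, hεr⟩ := hnatg.2 i
      rw [hφD, hδ, hε]
      exact map_derivation_eq Λ δ ε (fun r => by rw [hδr, hΛ, hΛ, hεr, hd.ρ_polyDir]) x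
    | add v w hv hw => rw [map_add, add_smul, add_smul, map_add, hv, hw]
    | mul v w hv hw => rw [map_mul, mul_smul, mul_smul, hv, hw]
  · obtain ⟨i, r, hr⟩ := exists_mul_pow_eq f' x
    have h1 := congrArg Λ hr
    rw [AlgHom.toLinearMap_apply] at hx
    rw [map_mul, hx, zero_mul, hΛ] at h1
    have hρr : ρ r = 0 := algebraMap_away_injective hg0 (by rw [map_zero]; exact h1.symm)
    obtain ⟨s, rfl⟩ := hd.dvd_of_ρ_eq_zero hρr
    obtain ⟨y, hy⟩ := exists_div_pow f' s i
    refine ⟨y, (isUnit_algebraMap_pow f' i).mul_right_cancel ?_⟩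
    rw [hnatf'.weylPoly_smul, mul_assoc, hy, hr, map_mul]

theorem IsAffineChart.chain [CharZero K] (hd : IsAffineChart h ρ p c a J b)
    (hf : f = h * f') (hf'0 : f' ≠ 0) (hg0 : g ≠ 0) {j k : ℕ} (hgf : g ∣ ρ f' ^ j)
    (hfg : ρ f' ∣ g ^ k)
    [Module (Weyl K (n + 1)) (Localization.Away f)]
    [IsScalarTower K (Weyl K (n + 1)) (Localization.Away f)] (hnatf : NatActs K (n + 1) f)
    [Module (Weyl K (n + 1)) (Localization.Away f')]
    [IsScalarTower K (Weyl K (n + 1)) (Localization.Away f')] (hnatf' : NatActs K (n + 1) f')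
    [Module (Weyl K n) (Localization.Away g)]
    [IsScalarTower K (Weyl K n) (Localization.Away g)] (hnatg : NatActs K n g)
    {ℓ' ℓ'' : ℕ} (h' : CanonicalChain (weylLinear K (n + 1)) (n + 1) (polyRange f') ⊤ ℓ')
    (h'' : CanonicalChain (weylLinear K n) n (polyRange g) ⊤ ℓ'') :
    CanonicalChain (weylLinear K (n + 1)) (n + 1) (polyRange f) ⊤ (ℓ' + ℓ'' + 1) := by
  have hf0 : f ≠ 0 := hf ▸ mul_ne_zero hd.h_ne_zero hf'0
  obtain ⟨φ, hφ, hφX, hφD⟩ := hd.exists_isTransversal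
  obtain ⟨ι, hinj, hι, hmul⟩ := hnatf'.exists_linearMap hnatf hf0 (k := 1)
    (by rw [pow_one, hf]; exact dvd_mul_left _ _)
  obtain ⟨ev, T, hT⟩ := hd.exists_isResidueDatum hf hg0 hgf hfg hnatf hnatf' hnatg hφ hφX hφD
    hinj hι hmul
  have h1 := h'.map ι fun m hm => by
    rw [hinj (hm.trans (map_zero ι).symm)]
    exact Submodule.zero_mem _
  rw [NatActs.map_polyRange hι, Submodule.map_top] at h1
  have h2 := hT.chain hφ ((hnatg.chain_polyRange hg0).trans h'')
  have h3 := h1.trans h2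
  rwa [add_comm 1, ← add_assoc] at h3

end DeletionRestriction

section NaturalStructure

variable {K : Type} [Field K] {n : ℕ}

theorem exists_localization_derivation (f : MvPolynomial (Fin n) K)
    (d : Derivation K (MvPolynomial (Fin n) K) (MvPolynomial (Fin n) K)) :
    ∃ δ : Derivation K (Localization.Away f) (Localization.Away f),
      ∀ r : MvPolynomial (Fin n) K, δ (algebraMap _ _ r) = algebraMap _ _ (d r) := by
  have : Algebra.FormallyEtale (MvPolynomial (Fin n) K) (Localization.Away f) :=
    Algebra.FormallyEtale.of_isLocalization (Submonoid.powers f)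
  have hbc := KaehlerDifferential.isBaseChange_of_formallyEtale K (MvPolynomial (Fin n) K)
    (Localization.Away f)
  set D : Derivation K (MvPolynomial (Fin n) K) (Localization.Away f) :=
    (Algebra.linearMap (MvPolynomial (Fin n) K) (Localization.Away f)).compDer d
  refine ⟨(hbc.lift D.liftKaehlerDifferential).compDer (KaehlerDifferential.D K _), fun r => ?_⟩
  have h := hbc.lift_eq D.liftKaehlerDifferential (KaehlerDifferential.D K _ r)
  rw [KaehlerDifferential.map_D, Derivation.liftKaehlerDifferential_comp_D] at h
  exact h

theorem exists_natActs (f : MvPolynomial (Fin n) K) :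
    ∃ (_ : Module (Weyl K n) (Localization.Away f))
      (_ : IsScalarTower K (Weyl K n) (Localization.Away f)), NatActs K n f := by
  choose δ hδ using fun i => exists_localization_derivation f (MvPolynomial.pderiv i)
  have hcomm : ∀ i j m, δ i (δ j m) = δ j (δ i m) := by
    intro i j m
    have hbr : (⁅δ i, δ j⁆ : Derivation K (Localization.Away f) (Localization.Away f)) m = 0 := by
      have hpd : ⁅MvPolynomial.pderiv i, MvPolynomial.pderiv j⁆ =
          (0 : Derivation K (MvPolynomial (Fin n) K) (MvPolynomial (Fin n) K)) :=
        MvPolynomial.derivation_ext fun k => by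
          rw [Derivation.commutator_apply, MvPolynomial.pderiv_X, MvPolynomial.pderiv_X]
          simp [Pi.single_apply, apply_ite]
      refine map_derivation_eq (f := f) (AlgHom.id K (Localization.Away f)) ⁅δ i, δ j⁆ 0
        (fun r => ?_) m
      rw [Derivation.commutator_apply, hδ, hδ, hδ, hδ, ← map_sub, ← Derivation.commutator_apply, hpd]
      simp
    rwa [Derivation.commutator_apply, sub_eq_zero] at hbr
  obtain ⟨φ, hφX, hφD⟩ := exists_weyl_algHom (K := K) (n := n)
    (E := Module.End K (Localization.Away f))
    (fun i => LinearMap.mulLeft K (algebraMap (MvPolynomial (Fin n) K) _ (MvPolynomial.X i))) (fun i => (δ i).toLinearMap)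
    (fun i j => by
      ext m
      simp [mul_left_comm])
    (fun i j => by
      refine LinearMap.ext fun m => ?_
      simp [hcomm i j m])
    (fun i j => by
      refine LinearMap.ext fun m => ?_
      rw [LinearMap.add_apply, Module.End.mul_apply, Module.End.mul_apply, LinearMap.mulLeft_apply,
        Derivation.coeFn_coe, Derivation.leibniz, hδ, LinearMap.mulLeft_apply, smul_eq_mul,
        MvPolynomial.pderiv_X]
      split_ifs with h
      · subst h; simp
      · simp [Pi.single_eq_of_ne' h])
  refine ⟨Module.compHom _ φ.toRingHom, ?_, ?_⟩
  · let _ : Module (Weyl K n) (Localization.Away f) := Module.compHom _ φ.toRingHom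
    refine ⟨fun a w m => ?_⟩
    change φ (a • w) m = a • φ w m
    rw [map_smul, LinearMap.smul_apply]
  · refine ⟨fun i m => ?_, fun i => ⟨δ i, fun m => ?_, hδ i⟩⟩
    · change φ (wX K n i) m = _
      rw [hφX, LinearMap.mulLeft_apply]
    · change φ (wD K n i) m = _
      rw [hφD]
      rfl

end NaturalStructure

section Existence

variable {K : Type} [Field K]

theorem exists_eq_affine_of_totalDegree_le_one [CharZero K] {σ : Type*} [Fintype σ]
    {q : MvPolynomial σ K} (hq : q.totalDegree ≤ 1) :
    ∃ (c₀ : K) (c : σ → K), q = MvPolynomial.C c₀ + ∑ i, c i • MvPolynomial.X i := by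
  classical
  have hpd : ∀ i, ∃ a, MvPolynomial.pderiv i q = MvPolynomial.C a := by
    intro i
    by_cases h : MvPolynomial.pderiv i q = 0
    · exact ⟨0, by rw [h, MvPolynomial.C_0]⟩
    · exact ⟨_, MvPolynomial.totalDegree_eq_zero_iff_eq_C.mp
        (Nat.lt_one_iff.mp ((totalDegree_pderiv_lt h).trans_le hq))⟩
  choose c hc using hpd
  refine ⟨_, c, sub_eq_iff_eq_add.mp (eq_C_of_pderiv_eq_zero fun i => ?_)⟩
  rw [map_sub, hc, map_sum, Finset.sum_eq_single i]
  · rw [Derivation.map_smul, MvPolynomial.pderiv_X_self, MvPolynomial.smul_eq_C_mul, mul_one,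
      sub_self]
  · intro j _ hj
    rw [Derivation.map_smul, MvPolynomial.pderiv_X_of_ne hj, smul_zero]
  · simp

theorem totalDegree_algHom_le_one [CharZero K] {σ τ : Type*} [Fintype σ]
    {ρ : MvPolynomial σ K →ₐ[K] MvPolynomial τ K}
    (hρ : ∀ i, (ρ (MvPolynomial.X i)).totalDegree ≤ 1) {q : MvPolynomial σ K}
    (hq : q.totalDegree ≤ 1) : (ρ q).totalDegree ≤ 1 := by
  obtain ⟨c₀, c, rfl⟩ := exists_eq_affine_of_totalDegree_le_one hq
  rw [← MvPolynomial.mem_restrictTotalDegree, map_add, ← MvPolynomial.algebraMap_eq,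
    AlgHom.commutes, MvPolynomial.algebraMap_eq, map_sum]
  refine add_mem ?_ (Submodule.sum_mem _ fun i _ => ?_)
  · rw [MvPolynomial.mem_restrictTotalDegree, MvPolynomial.totalDegree_C]
    exact Nat.zero_le _
  · rw [map_smul]
    exact Submodule.smul_mem _ _ ((MvPolynomial.mem_restrictTotalDegree _ _ _).mpr (hρ i))

theorem totalDegree_affine_le {σ : Type*} [Fintype σ] (c₀ : K) (c : σ → K) :
    (MvPolynomial.C c₀ + ∑ i, c i • MvPolynomial.X i : MvPolynomial σ K).totalDegree ≤ 1 := by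
  rw [← MvPolynomial.mem_restrictTotalDegree]
  refine add_mem ?_ (Submodule.sum_mem _ fun i _ => Submodule.smul_mem _ _ ?_)
  · rw [MvPolynomial.mem_restrictTotalDegree, MvPolynomial.totalDegree_C]
    exact Nat.zero_le _
  · rw [MvPolynomial.mem_restrictTotalDegree, MvPolynomial.totalDegree_X]

theorem IsAffineChart.totalDegree_ρ_le [CharZero K] {n : ℕ}
    {h : MvPolynomial (Fin (n + 1)) K}
    {ρ : MvPolynomial (Fin (n + 1)) K →ₐ[K] MvPolynomial (Fin n) K}
    {p c a : Fin (n + 1) → K} {J b : Fin n → Fin (n + 1) → K} (hd : IsAffineChart h ρ p c a J b)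
    {q : MvPolynomial (Fin (n + 1)) K} (hq : q.totalDegree ≤ 1) : (ρ q).totalDegree ≤ 1 :=
  totalDegree_algHom_le_one (fun i => by rw [hd.ρ_X]; exact totalDegree_affine_le _ _) hq

theorem affine_eq_affinePoly {n : ℕ} {c₀ : K} {p c : Fin n → K} (h : c₀ + ∑ i, c i * p i = 0) :
    (MvPolynomial.C c₀ + ∑ i, c i • MvPolynomial.X i : MvPolynomial (Fin n) K) =
      affinePoly p c := by
  simp only [affinePoly, smul_sub, Finset.sum_sub_distrib, MvPolynomial.smul_eq_C_mul,
    ← MvPolynomial.C_mul]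
  rw [← map_sum, eq_neg_of_add_eq_zero_left h, map_neg]
  ring

theorem exists_isAffineChart_affine {n : ℕ} (c₀ : K) {c : Fin (n + 1) → K} (hc : c ≠ 0) :
    ∃ ρ p a J b, IsAffineChart (MvPolynomial.C c₀ + ∑ i, c i • MvPolynomial.X i) ρ p c a J b := by
  obtain ⟨i₀, hi₀⟩ := Function.ne_iff.mp hc
  rw [Pi.zero_apply] at hi₀
  set p : Fin (n + 1) → K := Pi.single i₀ (-c₀ / c i₀) with hp
  set J : Fin n → Fin (n + 1) → K := fun k =>
    Pi.single (i₀.succAbove k) 1 - Pi.single i₀ (c (i₀.succAbove k) / c i₀) with hJ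
  set ρ : MvPolynomial (Fin (n + 1)) K →ₐ[K] MvPolynomial (Fin n) K :=
    MvPolynomial.aeval fun i => MvPolynomial.C (p i) + ∑ k, J k i • MvPolynomial.X k with hρ
  have hρX : ∀ i, ρ (MvPolynomial.X i) = MvPolynomial.C (p i) + ∑ k, J k i • MvPolynomial.X k :=
    fun i => by rw [hρ, MvPolynomial.aeval_X]
  have hcJ : ∀ k, ∑ i, c i * J k i = 0 := by
    intro k
    rw [Fin.sum_univ_succAbove _ i₀, Finset.sum_eq_single k]
    · simp [hJ, (Fin.succAbove_ne i₀ k).symm, mul_div_cancel₀ _ hi₀]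
    · intro j _ hj
      simp [hJ, hj]
    · simp
  have hcp : c₀ + ∑ i, c i * p i = 0 := by
    rw [Finset.sum_eq_single i₀]
    · rw [hp, Pi.single_eq_same, mul_div_cancel₀ _ hi₀, add_neg_cancel]
    · intro j _ hj
      rw [hp, Pi.single_eq_of_ne hj, mul_zero]
    · simp
  have hh : (MvPolynomial.C c₀ + ∑ i, c i • MvPolynomial.X i : MvPolynomial (Fin (n + 1)) K) =
      affinePoly p c := affine_eq_affinePoly hcp
  obtain ⟨a, b, hd⟩ := exists_isAffineChart (b := fun j => Pi.single (i₀.succAbove j) 1) hh hc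
    (by
      rw [hh, affinePoly, map_sum]
      simp only [map_smul, map_sub, hρX, ← MvPolynomial.algebraMap_eq, AlgHom.commutes,
        add_sub_cancel_left, Finset.smul_sum, smul_smul]
      rw [Finset.sum_comm]
      refine Finset.sum_eq_zero fun k _ => ?_
      rw [← Finset.sum_smul, hcJ, zero_smul]) hρX
    (fun j k => by
      rw [Finset.sum_eq_single (i₀.succAbove j)]
      · simp [hJ, Pi.single_apply]
      · intro i _ hi
        rw [Pi.single_eq_of_ne hi, zero_mul]
      · simp)
  exact ⟨ρ, p, a, J, b, hd⟩

theorem exists_canonicalChain [CharZero K] {n : ℕ} (l : List (MvPolynomial (Fin n) K))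
    (hl0 : ∀ q ∈ l, q ≠ 0) (hl1 : ∀ q ∈ l, q.totalDegree ≤ 1) {f : MvPolynomial (Fin n) K}
    (hf : f = l.prod) [Module (Weyl K n) (Localization.Away f)]
    [IsScalarTower K (Weyl K n) (Localization.Away f)] (hnat : NatActs K n f) :
    ∃ ℓ, CanonicalChain (weylLinear K n) n (polyRange f) ⊤ ℓ := by
  induction hN : l.length generalizing n with
  | zero =>
    rw [List.length_eq_zero_iff] at hN
    have htop : polyRange f = ⊤ := by
      refine eq_top_iff.mpr fun m _ => ?_
      obtain ⟨k, r, hr⟩ := exists_mul_pow_eq f m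
      have hf1 : f ^ k = 1 := by rw [hf, hN, List.prod_nil, one_pow]
      rw [hf1, map_one, mul_one] at hr
      exact ⟨r, hr.symm⟩
    exact ⟨0, htop ▸ CanonicalChain.refl _⟩
  | succ N ih =>
    obtain ⟨h, l', rfl⟩ := List.exists_cons_of_length_eq_add_one hN
    rw [List.length_cons, Nat.add_right_cancel_iff] at hN
    rw [List.forall_mem_cons] at hl0 hl1
    obtain ⟨f', hf'⟩ : ∃ f', f' = l'.prod := ⟨_, rfl⟩
    rw [List.prod_cons, ← hf'] at hf
    have hf'0 : f' ≠ 0 := hf' ▸ List.prod_ne_zero fun h0 => hl0.2 0 h0 rfl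
    have hf0 : f ≠ 0 := hf ▸ mul_ne_zero hl0.1 hf'0
    obtain ⟨_, _, hnat'⟩ := exists_natActs f'
    obtain ⟨ℓ', hℓ'⟩ := ih l' hl0.2 hl1.2 hf' hnat' hN
    have hdvd : f' ∣ f ^ 1 := by rw [pow_one, hf]; exact dvd_mul_left _ _
    obtain ⟨c₀, c, hh⟩ := exists_eq_affine_of_totalDegree_le_one hl1.1
    by_cases hc : c = 0
    · have hu : IsUnit h := by
        have hhC : h = MvPolynomial.C c₀ := by simpa [hc] using hh
        rw [hhC]
        exact (IsUnit.mk0 c₀ fun h0 => hl0.1 (by rw [hhC, h0, map_zero])).map MvPolynomial.C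
      refine ⟨ℓ', hnat'.chain_map hnat hf0 hdvd (j := 1) ?_ hℓ'⟩
      rw [pow_one, hf]
      exact (hu.mul_left_dvd).mpr dvd_rfl
    · obtain _ | m := n
      · exact absurd (Subsingleton.elim c 0) hc
      obtain ⟨ρ, p, a, J, b, hd⟩ := exists_isAffineChart_affine c₀ hc
      rw [← hh] at hd
      by_cases hρ : ρ f' = 0
      · refine ⟨ℓ', hnat'.chain_map hnat hf0 hdvd (j := 2) ?_ hℓ'⟩
        rw [hf, pow_two]
        exact mul_dvd_mul_right (hd.dvd_of_ρ_eq_zero hρ) _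
      · have hρ' : ρ f' = (l'.map ρ).prod := by rw [hf', map_list_prod]
        obtain ⟨_, _, hnat''⟩ := exists_natActs (ρ f')
        obtain ⟨ℓ'', hℓ''⟩ := ih (l'.map ρ)
          (fun q hq h0 => hρ (hρ' ▸ List.prod_eq_zero (h0 ▸ hq)))
          (fun q hq => by
            obtain ⟨r, hr, rfl⟩ := List.mem_map.mp hq
            exact hd.totalDegree_ρ_le (hl1.2 r hr)) hρ' hnat'' (by rw [List.length_map, hN])
        exact ⟨_, hd.chain hf hf'0 hρ (j := 1) (k := 1) (by rw [pow_one]) (by rw [pow_one]) hnat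
          hnat' hnat'' hℓ' hℓ''⟩

end Existence

section Restriction

variable {K : Type} [Field K]

theorem eval_algHom_apply {σ τ : Type*} (ψ : MvPolynomial σ K →ₐ[K] MvPolynomial τ K) (y : τ → K)
    (r : MvPolynomial σ K) :
    MvPolynomial.eval y (ψ r) =
      MvPolynomial.eval (fun i => MvPolynomial.eval y (ψ (MvPolynomial.X i))) r := by
  induction r using MvPolynomial.induction_on with
  | C a => rw [← MvPolynomial.algebraMap_eq, AlgHom.commutes]; simp
  | add p q hp hq => rw [map_add, map_add, map_add, hp, hq]
  | mul_X p i hp => rw [map_mul, map_mul, map_mul, hp, MvPolynomial.eval_X]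

theorem pderiv_algHom_apply {σ τ : Type*} [Fintype σ]
    (ψ : MvPolynomial σ K →ₐ[K] MvPolynomial τ K) (k : τ) (r : MvPolynomial σ K) :
    MvPolynomial.pderiv k (ψ r) =
      ∑ i, ψ (MvPolynomial.pderiv i r) * MvPolynomial.pderiv k (ψ (MvPolynomial.X i)) := by
  classical
  induction r using MvPolynomial.induction_on with
  | C a => rw [← MvPolynomial.algebraMap_eq, AlgHom.commutes]; simp
  | add p q hp hq => simp only [map_add, hp, hq, add_mul, Finset.sum_add_distrib]
  | mul_X p j hp =>
    simp only [map_mul, Derivation.leibniz, hp, smul_eq_mul, map_add, add_mul,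
      Finset.sum_add_distrib, MvPolynomial.pderiv_X, Pi.single_apply]
    congr 1
    · rw [Finset.sum_eq_single j (fun i _ hi => by simp [hi.symm]) (by simp)]
      simp
    · simp only [Finset.mul_sum, mul_assoc]

theorem exists_isAffineChart_of_totalDegree_eq_one [CharZero K] {n : ℕ}
    {q : MvPolynomial (Fin (n + 1)) K} (hq : q.totalDegree = 1) :
    ∃ ρ p c a J b, IsAffineChart q ρ p c a J b := by
  obtain ⟨c₀, c, rfl⟩ := exists_eq_affine_of_totalDegree_le_one hq.le
  have hc : c ≠ 0 := by
    rintro rfl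
    simp at hq
  obtain ⟨ρ, p, a, J, b, hd⟩ := exists_isAffineChart_affine c₀ hc
  exact ⟨ρ, p, c, a, J, b, hd⟩

theorem exists_eq_succ_of_totalDegree_eq_one {n : ℕ} {q : MvPolynomial (Fin n) K}
    (hq : q.totalDegree = 1) : ∃ m, n = m + 1 := by
  refine Nat.exists_eq_succ_of_ne_zero ?_
  rintro rfl
  rw [MvPolynomial.eq_C_of_isEmpty q, MvPolynomial.totalDegree_C] at hq
  exact zero_ne_one hq

theorem prime_of_totalDegree_eq_one [CharZero K] {n : ℕ} {q : MvPolynomial (Fin n) K}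
    (hq : q.totalDegree = 1) : Prime q := by
  obtain ⟨m, rfl⟩ := exists_eq_succ_of_totalDegree_eq_one hq
  obtain ⟨ρ, p, c, a, J, b, hd⟩ := exists_isAffineChart_of_totalDegree_eq_one hq
  exact hd.prime

theorem exists_eval_eq_zero [CharZero K] {n : ℕ} {q : MvPolynomial (Fin n) K}
    (hq : q.totalDegree = 1) : ∃ y, MvPolynomial.eval y q = 0 := by
  obtain ⟨m, rfl⟩ := exists_eq_succ_of_totalDegree_eq_one hq
  obtain ⟨ρ, p, c, a, J, b, hd⟩ := exists_isAffineChart_of_totalDegree_eq_one hq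
  refine ⟨_, (eval_algHom_apply ρ 0 q).symm.trans ?_⟩
  rw [hd.ρ_h, map_zero]

theorem dvd_of_forall_eval_eq_zero [CharZero K] {n : ℕ} {q r : MvPolynomial (Fin n) K}
    (hq : q.totalDegree = 1)
    (h : ∀ y, MvPolynomial.eval y q = 0 → MvPolynomial.eval y r = 0) : q ∣ r := by
  obtain ⟨m, rfl⟩ := exists_eq_succ_of_totalDegree_eq_one hq
  obtain ⟨ρ, p, c, a, J, b, hd⟩ := exists_isAffineChart_of_totalDegree_eq_one hq
  refine hd.dvd_of_ρ_eq_zero (MvPolynomial.funext fun y => ?_)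
  rw [map_zero, eval_algHom_apply]
  refine h _ ?_
  rw [← eval_algHom_apply, hd.ρ_h, map_zero]

theorem zeroSet_eq_of_dvd {n : ℕ} {q r : MvPolynomial (Fin n) K} (hq : q.totalDegree = 1)
    (hr : r.totalDegree = 1) (h : q ∣ r) : zeroSet K n q = zeroSet K n r := by
  obtain ⟨s, rfl⟩ := h
  have h0 : q * s ≠ 0 := by
    intro h0
    rw [h0, MvPolynomial.totalDegree_zero] at hr
    exact zero_ne_one hr
  rw [MvPolynomial.totalDegree_mul_of_isDomain (left_ne_zero_of_mul h0) (right_ne_zero_of_mul h0),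
    hq, Nat.add_eq_left, MvPolynomial.totalDegree_eq_zero_iff_eq_C] at hr
  have hs : MvPolynomial.coeff 0 s ≠ 0 := by
    intro hs
    rw [hs, map_zero] at hr
    exact h0 (by rw [hr, mul_zero])
  rw [hr]
  ext x
  simp [zeroSet, hs]

variable {n : ℕ} {h₀ : MvPolynomial (Fin (n + 1)) K}
  {π : MvPolynomial (Fin (n + 1)) K →ₐ[K] MvPolynomial (Fin n) K}

theorem linearTruncation_eq [CharZero K] {r : MvPolynomial (Fin n) K} (hr : r.totalDegree ≤ 1) :
    MvPolynomial.C (MvPolynomial.eval 0 r) +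
      ∑ k, MvPolynomial.eval 0 (MvPolynomial.pderiv k r) • MvPolynomial.X k = r := by
  classical
  obtain ⟨c₀, c, rfl⟩ := exists_eq_affine_of_totalDegree_le_one hr
  simp [MvPolynomial.pderiv_X, Pi.single_apply, apply_ite]

theorem exists_isAffineChart_of_surjective [CharZero K] (hh₀ : h₀.totalDegree = 1)
    (hπ : Function.Surjective π) (hπh : π h₀ = 0) :
    ∃ ρ p c a J b, IsAffineChart h₀ ρ p c a J b ∧
      ∀ q, q.totalDegree ≤ 1 → (π q).totalDegree ≤ 1 → ρ q = π q := by
  set p : Fin (n + 1) → K := fun i => MvPolynomial.eval 0 (π (MvPolynomial.X i)) with hp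
  set J : Fin n → Fin (n + 1) → K := fun k i =>
    MvPolynomial.eval 0 (MvPolynomial.pderiv k (π (MvPolynomial.X i))) with hJ
  set ρ : MvPolynomial (Fin (n + 1)) K →ₐ[K] MvPolynomial (Fin n) K :=
    MvPolynomial.aeval fun i => MvPolynomial.C (p i) + ∑ k, J k i • MvPolynomial.X k with hρ
  have hρX : ∀ i, ρ (MvPolynomial.X i) = MvPolynomial.C (p i) + ∑ k, J k i • MvPolynomial.X k :=
    fun i => by rw [hρ, MvPolynomial.aeval_X]
  have hρq : ∀ q, q.totalDegree ≤ 1 → ρ q = MvPolynomial.C (MvPolynomial.eval 0 (π q)) +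
      ∑ k, MvPolynomial.eval 0 (MvPolynomial.pderiv k (π q)) • MvPolynomial.X k := by
    intro q hq
    obtain ⟨c₀, c, rfl⟩ := exists_eq_affine_of_totalDegree_le_one hq
    simp only [map_add, map_sum, map_smul, hρX, ← MvPolynomial.algebraMap_eq, AlgHom.commutes,
      Derivation.map_algebraMap, Derivation.map_smul, MvPolynomial.smul_eval, Finset.sum_smul,
      zero_add, smul_add, Finset.sum_add_distrib, Finset.smul_sum, smul_smul]
    rw [Finset.sum_comm (s := Finset.univ) (t := Finset.univ), ← add_assoc]
    simp [hp, hJ, MvPolynomial.smul_eq_C_mul]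
  choose s hs using fun j : Fin n => hπ (MvPolynomial.X j)
  obtain ⟨c₀, c, hc⟩ := exists_eq_affine_of_totalDegree_le_one hh₀.le
  have hc0 : c ≠ 0 := by
    rintro rfl
    rw [hc] at hh₀
    simp at hh₀
  have hcp : c₀ + ∑ i, c i * p i = 0 := by
    have h1 := eval_algHom_apply π 0 h₀
    rw [hπh, map_zero, hc] at h1
    simpa [MvPolynomial.smul_eval, hp] using h1.symm
  have hh : h₀ = affinePoly p c := hc.trans (affine_eq_affinePoly hcp)
  obtain ⟨a, b, hd⟩ := exists_isAffineChart (ρ := ρ) (J := J)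
    (b := fun j i => MvPolynomial.eval p (MvPolynomial.pderiv i (s j))) hh hc0
    (by rw [hρq _ hh₀.le, hπh]; simp) hρX
    (fun j k => by
      have h1 := congrArg (MvPolynomial.eval 0) (pderiv_algHom_apply π k (s j))
      rw [hs, map_sum, MvPolynomial.pderiv_X] at h1
      refine (Finset.sum_congr rfl fun i _ => ?_).trans (h1.symm.trans ?_)
      · rw [map_mul, eval_algHom_apply π 0 (MvPolynomial.pderiv i (s j))]
      rw [Pi.single_apply, apply_ite (MvPolynomial.eval 0), map_one, map_zero])
  exact ⟨ρ, p, c, a, J, b, hd, fun q hq hq' => (hρq q hq).trans (linearTruncation_eq hq')⟩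

theorem IsAffineChart.exists_algEquiv
    {ρ : MvPolynomial (Fin (n + 1)) K →ₐ[K] MvPolynomial (Fin n) K}
    {p c a : Fin (n + 1) → K} {J b : Fin n → Fin (n + 1) → K} (hd : IsAffineChart h₀ ρ p c a J b)
    (hπ : Function.Surjective π) (hker : ∀ r, π r = 0 ↔ h₀ ∣ r) :
    ∃ θ : MvPolynomial (Fin n) K ≃ₐ[K] MvPolynomial (Fin n) K, ∀ r, θ (π r) = ρ r := by
  choose s hs using fun j : Fin n => hπ (MvPolynomial.X j)
  have hσ : ∀ t, π (MvPolynomial.aeval s t) = t := by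
    intro t
    have h : π.comp (MvPolynomial.aeval s) = AlgHom.id K _ :=
      MvPolynomial.algHom_ext fun j => by
        rw [AlgHom.comp_apply, MvPolynomial.aeval_X, hs, AlgHom.id_apply]
    exact DFunLike.congr_fun h t
  have hρσ : ∀ r, ρ (MvPolynomial.aeval s (π r)) = ρ r := by
    intro r
    rw [← sub_eq_zero, ← map_sub, hd.ρ_eq_zero_iff, ← hker, map_sub, hσ, sub_self]
  refine ⟨AlgEquiv.ofBijective (ρ.comp (MvPolynomial.aeval s)) ⟨?_, fun t => ?_⟩, hρσ⟩
  · rw [injective_iff_map_eq_zero]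
    intro t ht
    rw [AlgHom.comp_apply, hd.ρ_eq_zero_iff, ← hker, hσ] at ht
    exact ht
  · obtain ⟨r, rfl⟩ := hd.ρ_surjective t
    exact ⟨π r, hρσ r⟩

variable {ρ : MvPolynomial (Fin (n + 1)) K →ₐ[K] MvPolynomial (Fin n) K}
  {θ : MvPolynomial (Fin n) K ≃ₐ[K] MvPolynomial (Fin n) K}
  {q : MvPolynomial (Fin (n + 1)) K} {b : MvPolynomial (Fin n) K}

theorem associated_of_forall_eval_eq_zero [CharZero K] (hθ : ∀ r, θ (π r) = ρ r)
    (hρπ : ∀ q, q.totalDegree ≤ 1 → (π q).totalDegree ≤ 1 → ρ q = π q)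
    (hq : q.totalDegree ≤ 1) (hρq : (ρ q).totalDegree = 1) (hb : b.totalDegree = 1)
    (hZ : ∀ y, MvPolynomial.eval y b = 0 → MvPolynomial.eval y (π q) = 0) :
    Associated b (ρ q) := by
  have hirr : Irreducible (π q) := by
    rw [← MulEquiv.irreducible_iff θ, hθ]
    exact (prime_of_totalDegree_eq_one hρq).irreducible
  have hbirr := (prime_of_totalDegree_eq_one hb).irreducible
  have hassoc := hbirr.associated_of_dvd hirr (dvd_of_forall_eval_eq_zero hb hZ)
  rwa [hρπ q hq ((MvPolynomial.totalDegree_le_of_dvd_of_isDomain hassoc.symm.dvd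
    hbirr.ne_zero).trans hb.le)]

theorem exists_eval_eq_zero_of_totalDegree [CharZero K] (hθ : ∀ r, θ (π r) = ρ r)
    (hρq : (ρ q).totalDegree = 1) : ∃ y, MvPolynomial.eval y (π q) = 0 := by
  obtain ⟨z, hz⟩ := exists_eval_eq_zero hρq
  exact ⟨_, (eval_algHom_apply θ.toAlgHom z (π q)).symm.trans ((hθ q).symm ▸ hz)⟩

theorem isUnit_or_totalDegree_eq_one {σ : Type*} {r : MvPolynomial σ K} (hr : r.totalDegree ≤ 1)
    (hr0 : r ≠ 0) : IsUnit r ∨ r.totalDegree = 1 := by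
  refine (Nat.le_one_iff_eq_zero_or_eq_one.mp hr).imp_left fun h => ?_
  rw [MvPolynomial.totalDegree_eq_zero_iff_eq_C] at h
  rw [h]
  refine (IsUnit.mk0 _ fun h0 => hr0 ?_).map MvPolynomial.C
  rw [h, h0, map_zero]

theorem exists_canonicalChain_prod [CharZero K] {n : ℕ} {s : Finset (MvPolynomial (Fin n) K)}
    (hs : ∀ q ∈ s, q.totalDegree = 1) {f : MvPolynomial (Fin n) K} (hf : f = ∏ q ∈ s, q)
    [Module (Weyl K n) (Localization.Away f)] [IsScalarTower K (Weyl K n) (Localization.Away f)]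
    (hnat : NatActs K n f) :
    ∃ ℓ, CanonicalChain (weylLinear K n) n (polyRange f) ⊤ ℓ :=
  exists_canonicalChain s.toList
    (fun q hq => (prime_of_totalDegree_eq_one (hs q (Finset.mem_toList.mp hq))).ne_zero)
    (fun q hq => (hs q (Finset.mem_toList.mp hq)).le)
    (by rw [hf, ← Finset.prod_map_toList, List.map_id']) hnat

theorem prod_ne_zero_of_totalDegree_eq_one {σ : Type*} {s : Finset (MvPolynomial σ K)}
    (hs : ∀ q ∈ s, q.totalDegree = 1) : ∏ q ∈ s, q ≠ 0 :=
  Finset.prod_ne_zero_iff.mpr fun q hq h0 => by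
    have := hs q hq
    rw [h0, MvPolynomial.totalDegree_zero] at this
    exact zero_ne_one this

end Restriction

open scoped Classical in
/-- Deletion-restriction for multiplicity: for a hyperplane
arrangement defined by `f` in `R = K[x₁,…,x_{n'+1}]`, with `H₀ ∈ 𝒜` defined by
`h₀ ∈ A`, deleted arrangement defined by `f'`, and restricted arrangement in
`H₀ ≅ K^{n'}` defined by `f'' ∈ R'' ≅ K[x₁,…,x_{n'}]` (the identification
being given by the isomorphism `e : R/(h₀) ≅ R''`, with induced point
correspondence `pt`), one has
`mult H¹_{(f)}(R) = mult H¹_{(f')}(R) + mult H¹_{(f'')}(R'') + 1`. -/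
theorem mult_deletion_restriction
    (K : Type) [Field K] [CharZero K] (n' : ℕ)
    (A : Finset (MvPolynomial (Fin (n' + 1)) K))
    (hdegA : ∀ p ∈ A, p.totalDegree = 1)
    (hdist : ∀ p ∈ A, ∀ q ∈ A, p ≠ q →
      zeroSet K (n' + 1) p ≠ zeroSet K (n' + 1) q)
    (h₀ : MvPolynomial (Fin (n' + 1)) K) (hh₀ : h₀ ∈ A)
    (f f' : MvPolynomial (Fin (n' + 1)) K)
    (hf : f = ∏ p ∈ A, p) (hf' : f' = ∏ p ∈ A.erase h₀, p)
    (e : (MvPolynomial (Fin (n' + 1)) K ⧸ Ideal.span {h₀}) ≃ₐ[K]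
      MvPolynomial (Fin n') K)
    (pt : (Fin n' → K) → (Fin (n' + 1) → K))
    (hpt : ∀ (y : Fin n' → K) (q : MvPolynomial (Fin (n' + 1)) K),
      MvPolynomial.eval (pt y) q =
        MvPolynomial.eval y (e (Ideal.Quotient.mk (Ideal.span {h₀}) q)))
    (B : Finset (MvPolynomial (Fin n') K))
    (hdegB : ∀ b ∈ B, b.totalDegree = 1)
    (hBdist : ∀ b ∈ B, ∀ c ∈ B, b ≠ c → zeroSet K n' b ≠ zeroSet K n' c)
    (hB : B.image (zeroSet K n') =
      ((A.erase h₀).image fun q =>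
        {y : Fin n' → K | MvPolynomial.eval (pt y) q = 0}).filter
          fun X => X ≠ ∅)
    (f'' : MvPolynomial (Fin n') K) (hf'' : f'' = ∏ b ∈ B, b)
    [Module (Weyl K (n' + 1)) (Localization.Away f)]
    [IsScalarTower K (Weyl K (n' + 1)) (Localization.Away f)]
    (hnatf : NatActs K (n' + 1) f)
    [Module (Weyl K (n' + 1)) (Localization.Away f')]
    [IsScalarTower K (Weyl K (n' + 1)) (Localization.Away f')]
    (hnatf' : NatActs K (n' + 1) f')
    [Module (Weyl K n') (Localization.Away f'')]
    [IsScalarTower K (Weyl K n') (Localization.Away f'')]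
    (hnatf'' : NatActs K n' f'') :
    ∀ a b c : ℚ, HasMult K (n' + 1) (H1 K (n' + 1) f) a →
      HasMult K (n' + 1) (H1 K (n' + 1) f') b →
      HasMult K n' (H1 K n' f'') c → a = b + c + 1 := by
  intro a b c ha hb hc
  set π : MvPolynomial (Fin (n' + 1)) K →ₐ[K] MvPolynomial (Fin n') K :=
    (e : _ →ₐ[K] _).comp (Ideal.Quotient.mkₐ K (Ideal.span {h₀})) with hπ_def
  replace hpt : ∀ y q, MvPolynomial.eval (pt y) q = MvPolynomial.eval y (π q) := hpt
  have hπ : Function.Surjective π := e.surjective.comp Ideal.Quotient.mk_surjective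
  have hker : ∀ r, π r = 0 ↔ h₀ ∣ r := by
    intro r
    rw [← Ideal.mem_span_singleton, ← Ideal.Quotient.eq_zero_iff_mem]
    exact map_eq_zero_iff e e.injective
  obtain ⟨ρ, p, v, d, J, b', hd, hρπ⟩ :=
    exists_isAffineChart_of_surjective (hdegA h₀ hh₀) hπ ((hker h₀).mpr dvd_rfl)
  obtain ⟨θ, hθ⟩ := hd.exists_algEquiv hπ hker
  have hdegA' : ∀ q ∈ A.erase h₀, q.totalDegree = 1 := fun q hq =>
    hdegA q (Finset.mem_of_mem_erase hq)
  have hρ : ∀ q ∈ A.erase h₀, IsUnit (ρ q) ∨ (ρ q).totalDegree = 1 := by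
    intro q hq
    refine isUnit_or_totalDegree_eq_one (hd.totalDegree_ρ_le (hdegA' q hq).le) fun h0 => ?_
    exact hdist h₀ hh₀ q (Finset.mem_of_mem_erase hq) (Finset.ne_of_mem_erase hq).symm
      (zeroSet_eq_of_dvd (hdegA h₀ hh₀) (hdegA' q hq) (hd.dvd_of_ρ_eq_zero h0))
  have hρf' : ρ f' = ∏ q ∈ A.erase h₀, ρ q := by rw [hf', map_prod]
  have hB' : ∀ X, X ∈ B.image (zeroSet K n') ↔
      (∃ q ∈ A.erase h₀, {y | MvPolynomial.eval y (π q) = 0} = X) ∧ X ≠ ∅ := by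
    intro X
    rw [hB, Finset.mem_filter, Finset.mem_image]
    simp only [hpt]
  have hfg : ρ f' ∣ f'' ^ (A.erase h₀).card := by
    rw [hρf', ← Finset.prod_const]
    refine Finset.prod_dvd_prod_of_dvd _ _ fun q hq => ?_
    obtain hu | h1 := hρ q hq
    · exact hu.dvd
    obtain ⟨y, hy⟩ := exists_eval_eq_zero_of_totalDegree hθ h1
    obtain ⟨r, hr, hrq⟩ := Finset.mem_image.mp
      ((hB' _).mpr ⟨⟨q, hq, rfl⟩, Set.nonempty_iff_ne_empty.mp ⟨y, hy⟩⟩)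
    rw [hf'']
    exact (associated_of_forall_eval_eq_zero hθ hρπ (hdegA' q hq).le h1 (hdegB r hr)
      fun y hy => hrq.subset hy).symm.dvd.trans (Finset.dvd_prod_of_mem _ hr)
  have hgf : f'' ∣ ρ f' ^ B.card := by
    rw [hf'', ← Finset.prod_const]
    refine Finset.prod_dvd_prod_of_dvd _ _ fun r hr => ?_
    obtain ⟨⟨q, hq, hrq⟩, hne⟩ := (hB' _).mp (Finset.mem_image_of_mem (zeroSet K n') hr)
    obtain hu | h1 := hρ q hq
    · obtain ⟨y, hy⟩ := Set.nonempty_iff_ne_empty.mpr hne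
      rw [← hθ, MulEquiv.isUnit_map] at hu
      exact absurd (hrq.superset hy) (hu.map (MvPolynomial.eval y)).ne_zero
    rw [hρf']
    exact (associated_of_forall_eval_eq_zero hθ hρπ (hdegA' q hq).le h1 (hdegB r hr)
      fun y hy => hrq.superset hy).dvd.trans (Finset.dvd_prod_of_mem ρ hq)
  obtain ⟨ℓ', hℓ'⟩ := exists_canonicalChain_prod hdegA' hf' hnatf'
  obtain ⟨ℓ'', hℓ''⟩ := exists_canonicalChain_prod hdegB hf'' hnatf''
  have hℓ := hd.chain (by rw [hf, hf', Finset.mul_prod_erase A (fun q => q) hh₀])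
    (hf' ▸ prod_ne_zero_of_totalDegree_eq_one hdegA')
    (hf'' ▸ prod_ne_zero_of_totalDegree_eq_one hdegB) hgf hfg hnatf hnatf' hnatf'' hℓ' hℓ''
  rw [hnatf.mult_H1_eq hℓ ha, hnatf'.mult_H1_eq hℓ' hb, hnatf''.mult_H1_eq hℓ'' hc]
  push_cast
  rfl
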